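/- arXiv:1809.07711 — 5 statements merged into one kernel-verified Lean document; each statement's English description precedes it below -/
import Mathlib

section
/- Assume f satisfies (f1), (f2) and q satisfies (q1), (q2), and let u be a solution of (E) that reaches a double zero at some r₀ > 0, i.e. u(r₀) = 0 and u′(r₀) = 0. Then u does not change sign on [r₀,∞): either u(r) ≥ 0 for all r ≥ r₀ or u(r) ≤ 0 for all r ≥ r₀. Moreover, if u is not identically 0 on [r₀,∞), then there exists r₁ ≥ r₀ such that u ≡ 0 on [r₀,r₁] and, for every r > r₁, u(r) ≠ 0 and I(r) < 0, where I(r) := u′(r)² + 2F(u(r)). -/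
open Set Filter MeasureTheory Topology

noncomputable section

/-- `F(s) = ∫₀ˢ f(t) dt`. -/
def Fint (f : ℝ → ℝ) (s : ℝ) : ℝ := ∫ t in (0:ℝ)..s, f t

/-- `s ∈ (−c, c)` where `c ∈ (0, ∞]` is viewed as an extended real. -/
def InCC (c : EReal) (s : ℝ) : Prop := -c < (s : EReal) ∧ (s : EReal) < c

/-- A solution of equation (E):  `u'' + (q'/q) u' + f(u) = 0` on `(0,∞)`,
`u` with values in `(−c,c)`, `C¹` on `[0,∞)`, twice differentiable on `(0,∞)`,
and `u'(0) = 0`. -/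
structure IsSolutionE (c : EReal) (f q u : ℝ → ℝ) : Prop where
  mem : ∀ r : ℝ, 0 ≤ r → InCC c (u r)
  c1 : ContDiffOn ℝ 1 u (Ici (0:ℝ))
  diff2 : ∀ r : ℝ, 0 < r → DifferentiableAt ℝ (deriv u) r
  ode : ∀ r : ℝ, 0 < r →
    deriv (deriv u) r + (deriv q r / q r) * deriv u r + f (u r) = 0
  d0 : deriv u 0 = 0

/-- Condition (f1). -/
def CondF1 (c : EReal) (f : ℝ → ℝ) (b β : ℝ) : Prop :=
  (∀ s : ℝ, f (-s) = - f s) ∧ f 0 = 0 ∧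
  0 < b ∧ b < β ∧ (β : EReal) < c ∧
  (∀ s : ℝ, b < s → (s : EReal) < c → 0 < f s) ∧
  (∀ s : ℝ, s ∈ Icc (0:ℝ) b → f s ≤ 0) ∧
  (∃ s ∈ Icc (0:ℝ) b, f s ≠ 0) ∧
  Fint f β = 0

/-- Condition (f2). -/
def CondF2 (c : EReal) (f : ℝ → ℝ) : Prop :=
  ContDiffOn ℝ 1 f {s : ℝ | 0 < s ∧ (s : EReal) < c} ∧
  IntegrableOn (deriv f) (Ioo (0:ℝ) 1)

/-- Condition (q1). -/
def CondQ1 (q : ℝ → ℝ) : Prop :=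
  ContDiffOn ℝ 1 q (Ioi (0:ℝ)) ∧
  (∀ r : ℝ, 0 < r → 0 < q r ∧ 0 < deriv q r) ∧
  q 0 = 0 ∧ ContinuousWithinAt q (Ici (0:ℝ)) 0

/-- Condition (q2). -/
def CondQ2 (q : ℝ → ℝ) : Prop :=
  StrictAntiOn (fun r => deriv q r / q r) (Ioi (0:ℝ))

/-- `Q(r) = ∫₀ʳ q(s) ds`. -/
def Qint (q : ℝ → ℝ) (r : ℝ) : ℝ := ∫ s in (0:ℝ)..r, q s

/-- `H = (Q/q)'`. -/
def Hfun (q : ℝ → ℝ) (r : ℝ) : ℝ := deriv (fun t => Qint q t / q t) r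

/-- Condition (q3), with `Hinf = H∞`. -/
def CondQ3 (q : ℝ → ℝ) (Hinf : ℝ) : Prop :=
  AntitoneOn (Hfun q) (Ioi (0:ℝ)) ∧
  (∃ H0 : ℝ, Tendsto (Hfun q) (nhdsWithin 0 (Ioi 0)) (nhds H0) ∧ H0 < 1/2) ∧
  Tendsto (Hfun q) atTop (nhds Hinf) ∧ 0 < Hinf ∧
  MonotoneOn (fun r => q r * (Hfun q r - Hinf)) (Ioi (0:ℝ))

/-- Condition (f3). -/
def CondF3 (c : EReal) (f : ℝ → ℝ) (β Hinf : ℝ) : Prop :=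
  ∀ s : ℝ, β < s → (s : EReal) < c →
    (1 - 2 * Hinf) / 2 ≤ deriv (fun t => Fint f t / f t) s

/-- `h(r) = q(r) ∫_r^∞ ds / q(s)`. -/
def hfun (q : ℝ → ℝ) (r : ℝ) : ℝ := q r * ∫ s in Ioi r, 1 / q s

/-- Condition (q4), with `linf = ℓ∞`. -/
def CondQ4 (q : ℝ → ℝ) (linf : ℝ) : Prop :=
  IntegrableOn (fun r => 1 / q r) (Ioi (1:ℝ)) ∧
  ¬ IntegrableOn (fun r => 1 / q r) (Ioo (0:ℝ) 1) ∧
  (∀ r : ℝ, 0 < r → 0 < deriv (hfun q) r) ∧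
  AntitoneOn (deriv (hfun q)) (Ioi (0:ℝ)) ∧
  Tendsto (deriv (hfun q)) atTop (nhds linf) ∧ 0 < linf

/-- Condition (f4): `s ↦ s f'(s)/f(s)` is decreasing for `s ≥ b`. -/
def CondF4 (c : EReal) (f : ℝ → ℝ) (b : ℝ) : Prop :=
  StrictAntiOn (fun s => s * deriv f s / f s) {s : ℝ | b ≤ s ∧ (s : EReal) < c}

/-- Condition (q5). -/
def CondQ5 (q : ℝ → ℝ) : Prop :=
  StrictMonoOn (fun r => deriv q r * q r) (Ioi (0:ℝ))

/-- Condition (f5). -/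
def CondF5 (c : EReal) (f : ℝ → ℝ) (b : ℝ) : Prop :=
  ∀ s : ℝ, b ≤ s → (s : EReal) < c → deriv f s * (s - b) ≤ f s

/-- Condition (f6). -/
def CondF6 (f : ℝ → ℝ) (β linf : ℝ) : Prop :=
  β * deriv f β / f β ≤ 1 + 2 * linf

/-- `G(r) = (q'/(q h)) ∫₀ʳ h − 1/2`. -/
def Gfun (q : ℝ → ℝ) (r : ℝ) : ℝ :=
  deriv q r / (q r * hfun q r) * (∫ s in (0:ℝ)..r, hfun q s) - 1/2

/-- Condition (q6), with `Gbar = sup_{r>0} G(r)`. -/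
def CondQ6 (q : ℝ → ℝ) (Gbar : ℝ) : Prop :=
  (∀ r : ℝ, 0 < r → 0 ≤ Gfun q r) ∧
  IsLUB (Gfun q '' Ioi (0:ℝ)) Gbar ∧
  MonotoneOn (fun r => Gfun q r * hfun q r / Real.sqrt (∫ s in (0:ℝ)..r, hfun q s))
    (Ioi (0:ℝ))

/-- Condition (q7), with constant `C`. -/
def CondQ7 (q : ℝ → ℝ) (Gbar C : ℝ) : Prop :=
  Gbar ≤ C ∧ C ≤ 1 ∧
  ∃ a : ℝ, a ∈ Ioo (0:ℝ) 1 ∧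
    MonotoneOn (fun r => hfun q r ^ (1 - a) * (C - Gfun q r)) (Ioi (0:ℝ))

/-- Condition (f7). -/
def CondF7 (c : EReal) (f : ℝ → ℝ) (β C : ℝ) : Prop :=
  ∀ s : ℝ, β < s → (s : EReal) < c → C ≤ deriv (fun t => Fint f t / f t) s

/-- `u` has exactly `k` sign changes on `(0,∞)`: there are
`0 = z₀ < z₁ < ⋯ < z_k` such that for `i = 0,…,k` the function `(−1)^i u`
is nonnegative and not identically zero on `[z_i, z_{i+1}]` (with `z_{k+1} = ∞`). -/
def ExactSignChanges (u : ℝ → ℝ) (k : ℕ) : Prop :=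
  ∃ z : ℕ → ℝ, z 0 = 0 ∧ (∀ i, i < k → z i < z (i + 1)) ∧
    ∀ i, i ≤ k →
      (∀ r ∈ (if i < k then Icc (z i) (z (i + 1)) else Ici (z i)),
        0 ≤ (-1 : ℝ) ^ i * u r) ∧
      ∃ r ∈ (if i < k then Icc (z i) (z (i + 1)) else Ici (z i)),
        (-1 : ℝ) ^ i * u r ≠ 0

/-- A first variation `φ` along a solution `u` of (E). -/
structure IsFirstVariation (c : EReal) (f q u φ : ℝ → ℝ) : Prop where
  c1 : ContDiffOn ℝ 1 φ (Ici (0:ℝ))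
  init : φ 0 = 1
  dinit : deriv φ 0 = 0
  diff2 : ∀ r : ℝ, 0 < r → u r ≠ 0 → DifferentiableAt ℝ (deriv φ) r
  ode : ∀ r : ℝ, 0 < r → u r ≠ 0 →
    deriv (deriv φ) r + (deriv q r / q r) * deriv φ r + deriv f (u r) * φ r = 0

/-- The filter of approach to `Z ∈ (0,∞]` from the left. -/
def leftFilter (Z : EReal) : Filter ℝ :=
  if Z = ⊤ then atTop else nhdsWithin Z.toReal (Iio Z.toReal)

/-- `Z₁` for a single solution `w`: the supremum of the radii `r > 0` such that
`w > 0` and `w' < 0 ` on `(0,r)`. -/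
def Z1 (w : ℝ → ℝ) : EReal :=
  sSup {z : EReal | ∃ r : ℝ, z = (r : EReal) ∧ 0 < r ∧
    ∀ s : ℝ, 0 < s → s < r → 0 < w s ∧ deriv w s < 0}

lemma isOpen_setOf_inCC (c : EReal) : IsOpen {s : ℝ | InCC c s} :=
  isOpen_Ioo.preimage continuous_coe_real_ereal

lemma ordConnected_setOf_inCC (c : EReal) : OrdConnected {s : ℝ | InCC c s} :=
  (ordConnected_Ioo (a := -c) (b := c)).preimage_mono
    (fun _ _ h => EReal.coe_le_coe_iff.2 h)

lemma InCC.neg {c : EReal} {s : ℝ} (h : InCC c s) : InCC c (-s) := by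
  refine ⟨?_, ?_⟩
  · rw [EReal.coe_neg]; exact EReal.neg_lt_neg_iff.2 h.2
  · rw [EReal.coe_neg]; exact EReal.neg_lt_comm.1 h.1

lemma inCC_zero {c : EReal} (hc : 0 < c) : InCC c 0 := by
  refine ⟨?_, by simpa using hc⟩
  simpa using EReal.neg_lt_neg_iff.2 hc

lemma CondF2.contDiffAt {c : EReal} {f : ℝ → ℝ} (hf : CondF2 c f) {s : ℝ}
    (hs : 0 < s) (hsc : (s : EReal) < c) : ContDiffAt ℝ 1 f s := by
  refine hf.1.contDiffAt (IsOpen.mem_nhds ?_ ⟨hs, hsc⟩)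
  exact isOpen_Ioi.inter (isOpen_Iio.preimage continuous_coe_real_ereal)

/-- Under (f2), `f` has a limit at `0` from the right. -/
lemma CondF2.exists_tendsto {c : EReal} {f : ℝ → ℝ} (hc : 0 < c) (hf : CondF2 c f) :
    ∃ L, Tendsto f (𝓝[>] 0) (𝓝 L) := by
  obtain ⟨d, hd0, hdc⟩ := EReal.lt_iff_exists_real_btwn.1 (lt_min hc one_pos)
  have hd : 0 < d := by exact_mod_cast hd0
  have hdc' : (d : EReal) < c := hdc.trans_le (min_le_left _ _)
  have hd1 : d < 1 := by exact_mod_cast hdc.trans_le (min_le_right _ _)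
  have hint : IntegrableOn (deriv f) (uIcc 0 d) := by
    rw [uIcc_of_le hd.le, integrableOn_Icc_iff_integrableOn_Ioo]
    exact hf.2.mono_set (Ioo_subset_Ioo_right hd1.le)
  have hcont := (intervalIntegral.continuousOn_primitive_interval_left hint) 0 left_mem_uIcc
  refine ⟨f d - ∫ t in (0:ℝ)..d, deriv f t, ?_⟩
  have hlim : Tendsto (fun s => f d - ∫ t in s..d, deriv f t) (𝓝[>] 0)
      (𝓝 (f d - ∫ t in (0:ℝ)..d, deriv f t)) := by
    refine tendsto_const_nhds.sub (hcont.tendsto.mono_left ?_)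
    rw [uIcc_of_le hd.le, nhdsWithin_Icc_eq_nhdsGE hd]
    exact nhdsWithin_mono _ Ioi_subset_Ici_self
  refine hlim.congr' ?_
  filter_upwards [Ioo_mem_nhdsGT hd] with s hs
  rw [intervalIntegral.integral_eq_sub_of_hasDerivAt (f := f)]
  · ring
  · intro x hx
    rw [uIcc_of_le hs.2.le] at hx
    exact ((hf.contDiffAt (hs.1.trans_le hx.1)
      ((EReal.coe_le_coe_iff.2 hx.2).trans_lt hdc')).differentiableAt one_ne_zero).hasDerivAt
  · rw [intervalIntegrable_iff_integrableOn_Ioc_of_le hs.2.le]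
    refine hint.mono_set ?_
    rw [uIcc_of_le hd.le]
    exact fun x hx => ⟨hs.1.le.trans hx.1.le, hx.2⟩

/-- Subtracting its jump at the origin makes an odd function continuous. -/
lemma continuousAt_sub_sign {c : EReal} {f : ℝ → ℝ} {L : ℝ}
    (hodd : ∀ s, f (-s) = -f s) (hcont : ∀ s : ℝ, 0 < s → (s : EReal) < c → ContinuousAt f s)
    (hL : Tendsto f (𝓝[>] 0) (𝓝 L)) {s : ℝ} (hs : InCC c s) :
    ContinuousAt (fun t => f t - L * Real.sign t) s := by
  have hpos : ∀ s : ℝ, 0 < s → (s : EReal) < c →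
      ContinuousAt (fun t => f t - L * Real.sign t) s := by
    intro s hs hsc
    have : (fun t => f t - L) =ᶠ[𝓝 s] fun t => f t - L * Real.sign t := by
      filter_upwards [lt_mem_nhds hs] with t ht
      rw [Real.sign_of_pos ht, mul_one]
    exact ((hcont s hs hsc).sub continuousAt_const).congr this
  have hneg : (fun t => f t - L * Real.sign t)
      = fun t => -((fun t => f t - L * Real.sign t) (-t)) := by
    funext t
    simp only [hodd, Real.sign_neg]
    ring
  rcases lt_trichotomy s 0 with h | h | h
  · rw [hneg]
    exact ((hpos (-s) (neg_pos.2 h) hs.neg.2).comp (f := fun t : ℝ => -t)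
      continuous_neg.continuousAt).neg
  · subst h
    have h0 : f 0 = 0 := by have := hodd 0; rw [neg_zero] at this; linarith
    have hr : Tendsto (fun t => f t - L * Real.sign t) (𝓝[>] 0) (𝓝 0) := by
      have : Tendsto (fun t => f t - L) (𝓝[>] 0) (𝓝 0) := by
        simpa using hL.sub_const L
      refine this.congr' ?_
      filter_upwards [self_mem_nhdsWithin] with t ht
      rw [Real.sign_of_pos ht, mul_one]
    have hl : Tendsto (fun t => f t - L * Real.sign t) (𝓝[<] 0) (𝓝 0) := by
      rw [hneg]
      have hn : Tendsto (fun t : ℝ => -t) (𝓝[<] 0) (𝓝[>] 0) := by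
        simpa using tendsto_neg_nhdsLT (a := (0:ℝ))
      simpa using (hr.comp hn).neg
    rw [continuousAt_iff_continuous_left'_right']
    constructor <;> simpa [ContinuousWithinAt, h0]
  · exact hpos s h hs.2

/-- `F` splits into a smooth part and a multiple of the absolute value. -/
lemma fint_eq_add_abs {c : EReal} {f : ℝ → ℝ} {L : ℝ} (hc : 0 < c)
    (hg : ∀ s, InCC c s → ContinuousAt (fun t => f t - L * Real.sign t) s) {s : ℝ}
    (hs : InCC c s) : Fint f s = Fint (fun t => f t - L * Real.sign t) s + L * |s| := by
  set g := fun t => f t - L * Real.sign t with hgdef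
  have hgi : IntervalIntegrable g volume 0 s :=
    ContinuousOn.intervalIntegrable fun t ht => (hg t
      ((ordConnected_setOf_inCC c).uIcc_subset (inCC_zero hc) hs ht)).continuousWithinAt
  unfold Fint
  rcases le_total 0 s with h | h
  · have : ∫ t in (0:ℝ)..s, f t = ∫ t in (0:ℝ)..s, (g t + L) := by
      refine intervalIntegral.integral_congr_ae (ae_of_all _ fun t ht => ?_)
      rw [uIoc_of_le h] at ht
      simp [hgdef, Real.sign_of_pos ht.1]
    rw [this, intervalIntegral.integral_add hgi intervalIntegrable_const,
      intervalIntegral.integral_const, abs_of_nonneg h]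
    simp [mul_comm]
  · have : ∫ t in s..(0:ℝ), f t = ∫ t in s..(0:ℝ), (g t - L) := by
      refine intervalIntegral.integral_congr_ae ?_
      filter_upwards [compl_mem_ae_iff.2 (measure_singleton (μ := volume) (0:ℝ))] with t h0 ht
      rw [uIoc_of_le h] at ht
      simp [hgdef, Real.sign_of_neg (lt_of_le_of_ne ht.2 h0)]
    rw [intervalIntegral.integral_symm, this,
      intervalIntegral.integral_sub hgi.symm intervalIntegrable_const,
      intervalIntegral.integral_const, abs_of_nonpos h, intervalIntegral.integral_symm 0 s]
    simp [mul_comm, add_comm]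

lemma hasDerivAt_fint {c : EReal} {g : ℝ → ℝ} (hc : 0 < c)
    (hg : ∀ s, InCC c s → ContinuousAt g s) {s : ℝ} (hs : InCC c s) :
    HasDerivAt (Fint g) (g s) s := by
  have hgi : IntervalIntegrable g volume 0 s :=
    ContinuousOn.intervalIntegrable fun t ht => (hg t
      ((ordConnected_setOf_inCC c).uIcc_subset (inCC_zero hc) hs ht)).continuousWithinAt
  exact intervalIntegral.integral_hasDerivAt_right hgi
    (ContinuousAt.stronglyMeasurableAtFilter (isOpen_setOf_inCC c) hg s hs) (hg s hs)

lemma hasDerivAt_abs_of_eq_zero {u : ℝ → ℝ} {r : ℝ} (hu : HasDerivAt u 0 r) (h0 : u r = 0) :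
    HasDerivAt (fun t => |u t|) 0 r := by
  rw [hasDerivAt_iff_isLittleO] at hu ⊢
  simpa [h0] using hu.norm_left

lemma IsSolutionE.hasDerivAt {c : EReal} {f q u : ℝ → ℝ} (hu : IsSolutionE c f q u) {r : ℝ}
    (hr : 0 < r) : HasDerivAt u (deriv u r) r :=
  ((hu.c1.contDiffAt (Ici_mem_nhds hr)).differentiableAt one_ne_zero).hasDerivAt

/-- A solution cannot cross zero transversally when `f` jumps at the origin. -/
lemma IsSolutionE.limit_eq_zero_of_crossing {c : EReal} {f q u : ℝ → ℝ} {L : ℝ}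
    (hu : IsSolutionE c f q u) (hq : CondQ1 q) (hodd : ∀ s, f (-s) = -f s)
    (hL : Tendsto f (𝓝[>] 0) (𝓝 L)) {r : ℝ} (hr : 0 < r) (hur : u r = 0)
    (hdur : deriv u r ≠ 0) : L = 0 := by
  have hcu := (hu.hasDerivAt hr).continuousAt
  have hL' : Tendsto f (𝓝[<] 0) (𝓝 (-L)) := by
    have hn : Tendsto (fun t : ℝ => -t) (𝓝[<] 0) (𝓝[>] 0) := by
      simpa using tendsto_neg_nhdsLT (a := (0:ℝ))
    exact ((hL.comp hn).neg).congr fun t => by simp [hodd]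
  obtain ⟨M, hM, hlim⟩ : ∃ M, (M = 0 → L = 0) ∧
      Tendsto (fun t => f (u t)) (𝓝[>] r) (𝓝 M) := by
    have hu0 : Tendsto u (𝓝[>] r) (𝓝 0) := by
      simpa [hur] using hcu.tendsto.mono_left (nhdsWithin_le_nhds (s := Ioi r))
    have hslope := (hasDerivAt_iff_tendsto_slope.1 (hu.hasDerivAt hr)).mono_left
      (nhdsWithin_mono r (fun x (hx : x ∈ Ioi r) => ne_of_gt hx))
    rcases lt_or_gt_of_ne hdur with h | h
    · refine ⟨-L, by simp, hL'.comp (tendsto_nhdsWithin_iff.2 ⟨hu0, ?_⟩)⟩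
      filter_upwards [hslope.eventually_lt_const h, self_mem_nhdsWithin] with t ht htr
      rw [slope_def_field, hur, sub_zero] at ht
      exact neg_of_div_neg_left ht (sub_pos.2 htr).le
    · refine ⟨L, id, hL.comp (tendsto_nhdsWithin_iff.2 ⟨hu0, ?_⟩)⟩
      filter_upwards [hslope.eventually_const_lt h, self_mem_nhdsWithin] with t ht htr
      rw [slope_def_field, hur, sub_zero] at ht
      exact (div_pos_iff_of_pos_right (sub_pos.2 htr)).1 ht
  refine hM ?_
  have hqr : ContinuousAt (fun t => deriv q t / q t) r := by
    have h1 : ContinuousAt (deriv q) r :=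
      (hq.1.continuousOn_deriv_of_isOpen isOpen_Ioi le_rfl).continuousAt (Ioi_mem_nhds hr)
    exact h1.div (hq.1.continuousOn.continuousAt (Ioi_mem_nhds hr)) (hq.2.1 r hr).1.ne'
  have hd2 : Tendsto (deriv (deriv u)) (𝓝[>] r)
      (𝓝 (-(deriv q r / q r * deriv u r + M))) := by
    have h1 := (hqr.mul (hu.diff2 r hr).continuousAt).tendsto.mono_left
      (nhdsWithin_le_nhds (s := Ioi r))
    refine (h1.add hlim).neg.congr' ?_
    filter_upwards [self_mem_nhdsWithin] with t ht
    have := hu.ode t (hr.trans ht)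
    simp only [Pi.mul_apply]
    linarith
  have hder := hasDerivWithinAt_Ici_of_tendsto_deriv (s := Ioi r)
    (fun t ht => (hu.diff2 t (hr.trans ht)).differentiableWithinAt)
    (hu.diff2 r hr).continuousAt.continuousWithinAt self_mem_nhdsWithin hd2
  have huniq := (uniqueDiffOn_Ici r r self_mem_Ici).eq_deriv _ hder
    (hu.diff2 r hr).hasDerivAt.hasDerivWithinAt
  have hode := hu.ode r hr
  have h0 : f (u r) = 0 := by
    have := hodd 0
    rw [neg_zero] at this
    rw [hur]; linarith
  linarith

/-- The energy identity `I' = -2 (q'/q) u'²`. -/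
lemma IsSolutionE.hasDerivAt_energy {c : EReal} {f q u : ℝ → ℝ} (hc : 0 < c)
    (hu : IsSolutionE c f q u) (hq : CondQ1 q) (hodd : ∀ s, f (-s) = -f s) (hf2 : CondF2 c f)
    {r : ℝ} (hr : 0 < r) :
    HasDerivAt (fun t => (deriv u t) ^ 2 + 2 * Fint f (u t))
      (-2 * (deriv q r / q r) * (deriv u r) ^ 2) r := by
  obtain ⟨L, hL⟩ := hf2.exists_tendsto hc
  have hg : ∀ s, InCC c s → ContinuousAt (fun t => f t - L * Real.sign t) s := fun s hs =>
    continuousAt_sub_sign hodd (fun s h h' => (hf2.contDiffAt h h').continuousAt) hL hs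
  have hur := hu.hasDerivAt hr
  have hG := (hasDerivAt_fint hc hg (hu.mem r hr.le)).comp r hur
  have habs : HasDerivAt (fun t => L * |u t|) (L * Real.sign (u r) * deriv u r) r := by
    by_cases h0 : u r = 0
    · by_cases h1 : deriv u r = 0
      · rw [h1] at hur
        simpa [h1] using (hasDerivAt_abs_of_eq_zero hur h0).const_mul L
      · have := hu.limit_eq_zero_of_crossing hq hodd hL hr h0 h1
        subst this
        simpa using hasDerivAt_const r (0:ℝ)
    · rw [mul_assoc]
      refine HasDerivAt.const_mul L ?_
      rcases lt_or_gt_of_ne h0 with h | h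
      · rw [Real.sign_of_neg h]
        exact (hasDerivAt_abs_neg h).comp r hur
      · rw [Real.sign_of_pos h]
        exact (hasDerivAt_abs_pos h).comp r hur
  have hF : HasDerivAt (fun t => Fint f (u t)) (f (u r) * deriv u r) r := by
    have hsum := hG.add habs
    refine (hsum.congr_of_eventuallyEq ?_).congr_deriv (by ring)
    filter_upwards [lt_mem_nhds hr] with t ht
    exact fint_eq_add_abs hc hg (hu.mem t ht.le)
  have hode := hu.ode r hr
  refine (((hu.diff2 r hr).hasDerivAt.pow 2).add (hF.const_mul 2)).congr_deriv ?_
  have : deriv (deriv u) r = -(deriv q r / q r) * deriv u r - f (u r) := by linarith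
  rw [this]
  push_cast
  ring

/-- After a double zero, a solution of (E) does not change sign;
if it is not identically zero afterwards, it vanishes on an interval `[r₀,r₁]`
and then never vanishes, with negative energy. -/
theorem after_double_zero
    (c : EReal) (f q : ℝ → ℝ) (b β : ℝ) (hc : 0 < c)
    (hf1 : CondF1 c f b β) (hf2 : CondF2 c f)
    (hq1 : CondQ1 q) (hq2 : CondQ2 q)
    (u : ℝ → ℝ) (hu : IsSolutionE c f q u)
    (r₀ : ℝ) (hr₀ : 0 < r₀) (hz : u r₀ = 0) (hdz : deriv u r₀ = 0) :
    ((∀ r : ℝ, r₀ ≤ r → 0 ≤ u r) ∨ (∀ r : ℝ, r₀ ≤ r → u r ≤ 0)) ∧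
    ((¬ ∀ r : ℝ, r₀ ≤ r → u r = 0) →
      ∃ r₁ : ℝ, r₀ ≤ r₁ ∧ (∀ r ∈ Icc r₀ r₁, u r = 0) ∧
        ∀ r : ℝ, r₁ < r → u r ≠ 0 ∧ (deriv u r) ^ 2 + 2 * Fint f (u r) < 0) := by
  set I : ℝ → ℝ := fun t => (deriv u t) ^ 2 + 2 * Fint f (u t) with hI
  have hId : ∀ r, 0 < r → HasDerivAt I (-2 * (deriv q r / q r) * (deriv u r) ^ 2) r :=
    fun r hr => hu.hasDerivAt_energy hc hq1 hf1.1 hf2 hr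
  have hqq : ∀ r, 0 < r → 0 < deriv q r / q r :=
    fun r hr => div_pos (hq1.2.1 r hr).2 (hq1.2.1 r hr).1
  have hanti : AntitoneOn I (Ioi 0) := by
    refine antitoneOn_of_deriv_nonpos (convex_Ioi 0)
      (fun r hr => (hId r hr).continuousAt.continuousWithinAt)
      (fun r hr => ?_) (fun r hr => ?_)
    · rw [interior_Ioi] at hr
      exact (hId r hr).differentiableAt.differentiableWithinAt
    · rw [interior_Ioi] at hr
      rw [(hId r hr).deriv]
      nlinarith [mul_nonneg (hqq r hr).le (sq_nonneg (deriv u r))]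
  have hF0 : Fint f 0 = 0 := by simp [Fint]
  have hI0 : I r₀ = 0 := by simp [hI, hz, hdz, hF0]
  have hneg : ∀ r s, r₀ ≤ s → s < r → u s ≠ 0 → I r < 0 := by
    intro r s hs hsr hus
    by_contra! hIr
    have hIz : ∀ t ∈ Icc r₀ r, I t = 0 := fun t ht => le_antisymm
      (hI0 ▸ hanti hr₀ (hr₀.trans_le ht.1) ht.1)
      (hIr.trans (hanti (hr₀.trans_le ht.1) (hr₀.trans_le (ht.1.trans ht.2)) ht.2))
    have hdu : ∀ t ∈ Ioo r₀ r, deriv u t = 0 := by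
      intro t ht
      have ht0 := hr₀.trans ht.1
      have hev : I =ᶠ[𝓝 t] fun _ => 0 := by
        filter_upwards [Ioo_mem_nhds ht.1 ht.2] with x hx
        exact hIz x (Ioo_subset_Icc_self hx)
      have h0 := (hId t ht0).unique ((hasDerivAt_const t (0:ℝ)).congr_of_eventuallyEq hev)
      have := (hqq t ht0).ne'
      simpa [this, (hq1.2.1 t ht0).1.ne', (hq1.2.1 t ht0).2.ne'] using h0
    rcases hs.eq_or_lt with h | h
    · exact hus (h ▸ hz)
    obtain ⟨x, hx, hxs⟩ := exists_hasDerivAt_eq_slope u (deriv u) h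
      (fun t ht => (hu.hasDerivAt (hr₀.trans_le ht.1)).continuousAt.continuousWithinAt)
      (fun t ht => hu.hasDerivAt (hr₀.trans ht.1))
    rw [hdu x ⟨hx.1, hx.2.trans hsr⟩, hz, sub_zero] at hxs
    exact (div_ne_zero hus (sub_pos.2 h).ne') hxs.symm
  by_cases hzero : ∀ r : ℝ, r₀ ≤ r → u r = 0
  · exact ⟨Or.inl fun r hr => (hzero r hr).ge, fun h => (h hzero).elim⟩
  have key : ∃ r₁ : ℝ, r₀ ≤ r₁ ∧ (∀ r ∈ Icc r₀ r₁, u r = 0) ∧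
      ∀ r : ℝ, r₁ < r → u r ≠ 0 ∧ I r < 0 := by
    push Not at hzero
    set S := {r : ℝ | r₀ ≤ r ∧ u r ≠ 0} with hS
    have hSne : S.Nonempty := hzero
    have hSb : BddBelow S := ⟨r₀, fun r hr => hr.1⟩
    have hle : r₀ ≤ sInf S := le_csInf hSne fun r hr => hr.1
    have hpos : ∀ r, sInf S < r → u r ≠ 0 ∧ I r < 0 := by
      intro r hr
      obtain ⟨s, hs, hsr⟩ := exists_lt_of_csInf_lt hSne hr
      have h := hneg r s hs.1 hsr hs.2
      refine ⟨fun h0 => ?_, h⟩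
      simp only [hI, h0, hF0] at h
      nlinarith [sq_nonneg (deriv u r)]
    have hlt : ∀ r, r₀ ≤ r → r < sInf S → u r = 0 := fun r hr hrS => by
      by_contra h
      exact notMem_of_lt_csInf hrS hSb ⟨hr, h⟩
    refine ⟨sInf S, hle, fun r hr => ?_, hpos⟩
    rcases hr.2.eq_or_lt with h | h
    · rcases hr.1.eq_or_lt with h' | h'
      · exact h' ▸ hz
      · have hc1 : Tendsto u (𝓝[<] r) (𝓝 (u r)) :=
          (hu.hasDerivAt (hr₀.trans h')).continuousAt.tendsto.mono_left nhdsWithin_le_nhds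
        refine tendsto_nhds_unique hc1 (tendsto_const_nhds.congr' ?_)
        filter_upwards [Ioo_mem_nhdsLT h'] with t ht
        exact (hlt t ht.1.le (h ▸ ht.2)).symm
    · exact hlt r hr.1 h
  refine ⟨?_, fun _ => key⟩
  obtain ⟨r₁, hr₁, hz₁, hn⟩ := key
  by_contra! hcon
  obtain ⟨⟨x, hx, hux⟩, y, hy, huy⟩ := hcon
  have hx1 : r₁ < x := by
    by_contra! h
    exact hux.ne (hz₁ x ⟨hx, h⟩)
  have hy1 : r₁ < y := by
    by_contra! h
    exact huy.ne' (hz₁ y ⟨hy, h⟩)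
  have hcont : ContinuousOn u (Ioi r₁) := fun t ht =>
    (hu.hasDerivAt ((hr₀.trans_le hr₁).trans ht)).continuousAt.continuousWithinAt
  obtain ⟨t, ht, hut⟩ := isPreconnected_Ioi.intermediate_value hx1 hy1 hcont ⟨hux.le, huy.le⟩
  exact (hn t ht).1 hut
end
end

section
/- Assume f satisfies (f1), (f2) and q satisfies (q1), (q2), and let u be a solution of (E). If u(r) converges to some ℓ ∈ (−c,c) as r → ∞, then f(ℓ) = 0 and u′(r) → 0 as r → ∞. -/
open Set Filter MeasureTheory Topology

noncomputable section

/-- If `u` converges at infinity and `(q u')' = -q g` with `q` positive, nondecreasing and `g`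
eventually bounded, then `u'` is eventually smaller than any given positive number. -/
lemma eventually_deriv_lt_of_tendsto {q u g : ℝ → ℝ} {ℓ M ε : ℝ}
    (hq : ∀ r, 0 < r → 0 < q r) (hmono : MonotoneOn q (Ioi 0))
    (hu : ∀ r, 0 < r → DifferentiableAt ℝ u r)
    (hqu : ∀ r, 0 < r → HasDerivAt (fun t => q t * deriv u t) (-(q r * g r)) r)
    (hM : 0 < M) (hg : ∀ᶠ r in atTop, |g r| ≤ M)
    (hlim : Tendsto u atTop (𝓝 ℓ)) (hε : 0 < ε) :
    ∀ᶠ r in atTop, deriv u r < ε := by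
  obtain ⟨δ, hδ⟩ : ∃ δ, δ = ε / (2 * M) := ⟨_, rfl⟩
  have hδ0 : 0 < δ := by rw [hδ]; positivity
  have hMδ : M * δ = ε / 2 := by rw [hδ]; field_simp
  obtain ⟨R, hR⟩ := eventually_atTop.1 hg
  have hdiff : Tendsto (fun r => u r - u (r - δ)) atTop (𝓝 0) := by
    simpa [← sub_eq_add_neg] using hlim.sub (hlim.comp (tendsto_atTop_add_const_right atTop (-δ) tendsto_id))
  have hsmall : ∀ᶠ r in atTop, u r - u (r - δ) < ε / 2 * δ :=
    hdiff.eventually_lt_const (by positivity)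
  filter_upwards [hsmall, eventually_ge_atTop (R + δ), eventually_gt_atTop δ] with r h1 h2 h3
  by_contra! hr
  have key : ∀ t ∈ Ioo (r - δ) r, ε / 2 ≤ deriv u t := by
    intro t ht
    have ht0 : 0 < t := by linarith [ht.1]
    have hr0 : 0 < r := ht0.trans ht.2
    obtain ⟨x, hx, hxe⟩ := exists_hasDerivAt_eq_slope (fun t => q t * deriv u t)
      (fun r => -(q r * g r)) ht.2
      (fun x hx => (hqu x (ht0.trans_le hx.1)).continuousAt.continuousWithinAt)
      (fun x hx => hqu x (ht0.trans hx.1))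
    have hx0 : 0 < x := ht0.trans hx.1
    rw [eq_div_iff (by linarith [ht.2])] at hxe
    have hgx := neg_le_of_abs_le (hR x (by linarith [ht.1, hx.1]))
    have hqx : q x ≤ q r := hmono hx0 hr0 hx.2.le
    have hqt : q t ≤ q r := hmono ht0 hr0 ht.2.le
    have hbound : -(q x * g x) * (r - t) ≤ q r * (ε / 2) := by
      have e1 : -(q x * g x) ≤ q r * M := by
        nlinarith [mul_le_mul_of_nonneg_left hgx (hq x hx0).le]
      calc -(q x * g x) * (r - t) ≤ q r * M * (r - t) :=
            mul_le_mul_of_nonneg_right e1 (by linarith [ht.2])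
        _ ≤ q r * M * δ :=
            mul_le_mul_of_nonneg_left (by linarith [ht.1]) (mul_pos (hq r hr0) hM).le
        _ = q r * (ε / 2) := by rw [mul_assoc, hMδ]
    have hlow : q t * (ε / 2) ≤ q t * deriv u t := by
      have := mul_le_mul_of_nonneg_left hr (hq r hr0).le
      nlinarith
    exact le_of_mul_le_mul_left hlow (hq t ht0)
  have hpos : ∀ t ∈ Icc (r - δ) r, 0 < t := fun t ht => by linarith [ht.1]
  have := Convex.mul_sub_le_image_sub_of_le_deriv (convex_Icc (r - δ) r)
    (fun t ht => (hu t (hpos t ht)).continuousAt.continuousWithinAt)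
    (fun t ht => (hu t (hpos t (interior_subset ht))).differentiableWithinAt)
    (C := ε / 2) (fun t ht => key t (by simpa using ht)) (r - δ) (by simp [hδ0.le]) r
    (by simp [hδ0.le]) (by linarith)
  rw [sub_sub_cancel] at this
  linarith

/-- A function converging at infinity whose derivative also converges has derivative tending
to zero. -/
lemma eq_zero_of_tendsto_deriv {w : ℝ → ℝ} {a L : ℝ}
    (hw : ∀ r, 0 < r → DifferentiableAt ℝ w r)
    (hlim : Tendsto w atTop (𝓝 a)) (hd : Tendsto (deriv w) atTop (𝓝 L)) : L = 0 := by
  have hex : ∀ r : ℝ, 0 < r → ∃ x ∈ Ioo r (r + 1), deriv w x = w (r + 1) - w r := by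
    intro r hr
    obtain ⟨x, hx, h⟩ := exists_deriv_eq_slope w (lt_add_one r)
      (fun x hx => (hw x (hr.trans_le hx.1)).continuousAt.continuousWithinAt)
      (fun x hx => (hw x (hr.trans hx.1)).differentiableWithinAt)
    exact ⟨x, hx, by simpa using h⟩
  choose! ξ hξ using hex
  have hξtop : Tendsto ξ atTop atTop := by
    refine tendsto_atTop_mono' atTop ?_ tendsto_id
    filter_upwards [eventually_gt_atTop 0] with r hr using (hξ r hr).1.1.le
  have h0 : Tendsto (fun r => w (r + 1) - w r) atTop (𝓝 0) := by
    simpa using (hlim.comp (tendsto_atTop_add_const_right atTop 1 tendsto_id)).sub hlim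
  refine tendsto_nhds_unique (hd.comp hξtop) (h0.congr' ?_)
  filter_upwards [eventually_gt_atTop 0] with r hr using (hξ r hr).2.symm

lemma isOpen_pos_lt_coe (c : EReal) : IsOpen {s : ℝ | 0 < s ∧ (s : EReal) < c} :=
  (isOpen_lt continuous_const continuous_id).inter
    (isOpen_lt continuous_coe_real_ereal continuous_const)

lemma CondF2.continuousAt {c : EReal} {f : ℝ → ℝ} (hodd : ∀ s, f (-s) = -f s)
    (hf2 : CondF2 c f) {ℓ : ℝ} (hℓ : InCC c ℓ) (h0 : ℓ ≠ 0) : ContinuousAt f ℓ := by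
  have hpos : ∀ s : ℝ, 0 < s → (s : EReal) < c → ContinuousAt f s := fun s h1 h2 =>
    hf2.1.continuousOn.continuousAt ((isOpen_pos_lt_coe c).mem_nhds ⟨h1, h2⟩)
  rcases lt_or_gt_of_ne h0 with h | h
  · have hneg : ContinuousAt f (-ℓ) := by
      refine hpos _ (by linarith) ?_
      rw [EReal.coe_neg]
      exact EReal.neg_lt_comm.1 hℓ.1
    have := (hneg.comp (f := fun s : ℝ => -s) continuous_neg.continuousAt).neg
    refine this.congr (Eventually.of_forall fun s => ?_)
    simp [hodd]
  · exact hpos ℓ h hℓ.2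

lemma CondF2.exists_eventually_abs_le_zero {c : EReal} {f : ℝ → ℝ} (hc : 0 < c)
    (hodd : ∀ s, f (-s) = -f s) (hf2 : CondF2 c f) :
    ∃ M, ∀ᶠ s in 𝓝 (0 : ℝ), |f s| ≤ M := by
  obtain ⟨x, hx0, hxc⟩ := EReal.lt_iff_exists_real_btwn.1 hc
  have hx0 : 0 < x := by exact_mod_cast hx0
  set η := min x (1 / 2)
  have hη0 : 0 < η := by positivity
  have hη1 : η < 1 := (min_le_right _ _).trans_lt (by norm_num)
  have hηc : (η : EReal) < c := lt_of_le_of_lt (by exact_mod_cast min_le_left _ _) hxc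
  set I := ∫ t in Ioo (0 : ℝ) 1, ‖deriv f t‖
  have hpos : ∀ s, 0 < s → s < η → |f s| ≤ |f η| + I := by
    intro s hs hsη
    have hsub : Icc s η ⊆ {s : ℝ | 0 < s ∧ (s : EReal) < c} := fun t ht =>
      ⟨hs.trans_le ht.1, lt_of_le_of_lt (by exact_mod_cast ht.2) hηc⟩
    have hsub' : Ioc s η ⊆ Ioo 0 1 := fun t ht => ⟨hs.trans ht.1, ht.2.trans_lt hη1⟩
    have hint : IntervalIntegrable (deriv f) volume s η :=
      (intervalIntegrable_iff_integrableOn_Ioc_of_le hsη.le).2 (hf2.2.mono_set hsub')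
    have hftc : ∫ t in s..η, deriv f t = f η - f s := by
      refine intervalIntegral.integral_deriv_eq_sub (fun t ht => ?_) hint
      rw [uIcc_of_le hsη.le] at ht
      exact (hf2.1.differentiableOn one_ne_zero).differentiableAt
        ((isOpen_pos_lt_coe c).mem_nhds (hsub ht))
    have hle : |f η - f s| ≤ I := by
      rw [← hftc, ← Real.norm_eq_abs, intervalIntegral.integral_of_le hsη.le]
      refine (norm_integral_le_integral_norm _).trans ?_
      exact setIntegral_mono_set hf2.2.norm (Eventually.of_forall fun t => norm_nonneg _)
        (Eventually.of_forall hsub')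
    rw [abs_le] at hle
    have h1 := le_abs_self (f η)
    have h2 := neg_abs_le (f η)
    rw [abs_le]
    constructor <;> linarith [hle.1, hle.2]
  have hI : 0 ≤ I := integral_nonneg fun t => norm_nonneg _
  refine ⟨|f η| + I, ?_⟩
  filter_upwards [Ioo_mem_nhds (neg_lt_zero.2 hη0) hη0] with s hs
  rcases lt_trichotomy s 0 with h | h | h
  · have := hpos (-s) (by linarith) (by linarith [hs.1])
    rwa [hodd, abs_neg] at this
  · have : f 0 = 0 := by
      have := hodd 0
      rw [neg_zero] at this
      linarith
    rw [h, this, abs_zero]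
    positivity
  · exact hpos s h hs.2

lemma CondF2.exists_eventually_abs_le {c : EReal} {f : ℝ → ℝ} (hc : 0 < c)
    (hodd : ∀ s, f (-s) = -f s) (hf2 : CondF2 c f) {ℓ : ℝ} (hℓ : InCC c ℓ) :
    ∃ M, ∀ᶠ s in 𝓝 ℓ, |f s| ≤ M := by
  by_cases h0 : ℓ = 0
  · rw [h0]
    exact hf2.exists_eventually_abs_le_zero hc hodd
  · exact ⟨|f ℓ| + 1, ((hf2.continuousAt hodd hℓ h0).abs.eventually_lt_const
      (lt_add_one _)).mono fun _ h => h.le⟩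

/-- If a solution of (E) converges to `ℓ ∈ (−c,c)` at infinity,
then `f(ℓ) = 0` and `u' → 0`. -/
theorem limit_is_zero_of_f
    (c : EReal) (f q : ℝ → ℝ) (b β : ℝ) (hc : 0 < c)
    (hf1 : CondF1 c f b β) (hf2 : CondF2 c f)
    (hq1 : CondQ1 q) (hq2 : CondQ2 q)
    (u : ℝ → ℝ) (hu : IsSolutionE c f q u)
    (ℓ : ℝ) (hℓ : InCC c ℓ) (hlim : Tendsto u atTop (nhds ℓ)) :
    f ℓ = 0 ∧ Tendsto (deriv u) atTop (nhds 0) := by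
  obtain ⟨hodd, hf0, -⟩ := hf1
  obtain ⟨hqC, hqpos, -, -⟩ := hq1
  have hqd : ∀ r, 0 < r → DifferentiableAt ℝ q r := fun r hr =>
    (hqC.differentiableOn one_ne_zero).differentiableAt (Ioi_mem_nhds hr)
  have hud : ∀ r, 0 < r → DifferentiableAt ℝ u r := fun r hr =>
    (hu.c1.differentiableOn one_ne_zero).differentiableAt (Ici_mem_nhds hr)
  have hmono : MonotoneOn q (Ioi 0) :=
    (strictMonoOn_of_deriv_pos (convex_Ioi 0) hqC.continuousOn
      (fun r hr => (hqpos r (by simpa using hr)).2)).monotoneOn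
  have hqu : ∀ r, 0 < r → HasDerivAt (fun t => q t * deriv u t) (-(q r * f (u r))) r := by
    intro r hr
    have hq0 := (hqpos r hr).1.ne'
    refine ((hqd r hr).hasDerivAt.fun_mul (hu.diff2 r hr).hasDerivAt).congr_deriv ?_
    have hode := hu.ode r hr
    have hf : f (u r) = -(deriv (deriv u) r + deriv q r / q r * deriv u r) := by linarith
    rw [hf]
    field_simp
    ring
  obtain ⟨M, hM⟩ := hf2.exists_eventually_abs_le hc hodd hℓ
  have hM' : ∀ᶠ r in atTop, |f (u r)| ≤ |M| + 1 :=
    (hlim.eventually hM).mono fun r hr => by linarith [le_abs_self M]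
  have hMpos : 0 < |M| + 1 := by positivity
  have hu' : Tendsto (deriv u) atTop (𝓝 0) := by
    rw [tendsto_order]
    refine ⟨fun a ha => ?_, fun a ha => eventually_deriv_lt_of_tendsto
      (fun r hr => (hqpos r hr).1) hmono hud hqu hMpos hM' hlim ha⟩
    have hneg := eventually_deriv_lt_of_tendsto (u := fun r => -u r) (g := fun r => -f (u r))
      (fun r hr => (hqpos r hr).1) hmono (fun r hr => (hud r hr).neg)
      (fun r hr => by
        simpa [deriv.fun_neg] using (hqu r hr).fun_neg)
      hMpos (by simpa using hM') hlim.neg (neg_pos.2 ha)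
    filter_upwards [hneg] with r hr
    rw [deriv.fun_neg] at hr
    linarith
  refine ⟨?_, hu'⟩
  by_cases h0 : ℓ = 0
  · rw [h0, hf0]
  have hfu : Tendsto (fun r => f (u r)) atTop (𝓝 (f ℓ)) :=
    (hf2.continuousAt hodd hℓ h0).tendsto.comp hlim
  have hdamp : Tendsto (fun r => deriv q r / q r * deriv u r) atTop (𝓝 0) := by
    refine bdd_le_mul_tendsto_zero' (deriv q 1 / q 1) ?_ hu'
    filter_upwards [eventually_ge_atTop 1] with r hr
    have hr0 : (0 : ℝ) < r := by linarith
    rw [abs_of_pos (div_pos (hqpos r hr0).2 (hqpos r hr0).1)]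
    exact hq2.antitoneOn (mem_Ioi.2 one_pos) (mem_Ioi.2 hr0) hr
  have hu'' : Tendsto (deriv (deriv u)) atTop (𝓝 (-f ℓ)) := by
    have := (hdamp.add hfu).neg
    rw [zero_add] at this
    refine this.congr' ?_
    filter_upwards [eventually_gt_atTop 0] with r hr
    linarith [hu.ode r hr]
  exact neg_eq_zero.1 (eq_zero_of_tendsto_deriv hu.diff2 hu' hu'')
end
end

section
/- Assume f satisfies (f1), (f2) and q satisfies (q1), (q2). Let u be a solution of (E), let φ be a first variation along u, and let 0 ≤ r₁ < r₂ be two consecutive zeros of u′, i.e. u′(r₁) = u′(r₂) = 0 and u′(r) ≠ 0 for all r ∈ (r₁,r₂). Then φ vanishes at some point of (r₁, r₂]. -/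
open Set Filter MeasureTheory Topology

noncomputable section

lemma strictAntiOn_sub_mul_of_hasDerivAt {a b : ℝ} {g m m' p : ℝ → ℝ}
    (hg : ∀ x ∈ Ioo a b, HasDerivAt g (p x * m' x) x)
    (hm : ∀ x ∈ Ioo a b, HasDerivAt m (m' x) x)
    (hm' : ContinuousOn m' (Ioo a b)) (hp : StrictAntiOn p (Ioo a b))
    (hneg : ∀ x ∈ Ioo a b, m x < 0) :
    StrictAntiOn (fun x => g x - p x * m x) (Ioo a b) := by
  intro s hs t ht hst
  have hsub : Icc s t ⊆ Ioo a b := fun x hx =>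
    ⟨lt_of_lt_of_le hs.1 hx.1, lt_of_le_of_lt hx.2 ht.2⟩
  obtain ⟨K, hK⟩ := isCompact_Icc.exists_bound_of_continuousOn (hm'.mono hsub)
  obtain ⟨x₀, hx₀, hmax⟩ := isCompact_Icc.exists_isMaxOn (nonempty_Icc.2 hst.le)
    (fun x hx => (hm x (hsub hx)).continuousAt.continuousWithinAt : ContinuousOn m (Icc s t))
  have hε : 0 < -m x₀ := by linarith [hneg x₀ (hsub hx₀)]
  have hK0 : 0 ≤ K := (norm_nonneg _).trans (hK s (left_mem_Icc.2 hst.le))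
  obtain ⟨δ, hδ, hδK⟩ : ∃ δ > 0, K * δ < -m x₀ := by
    refine ⟨-m x₀ / (K + 1), by positivity, ?_⟩
    rw [mul_div_assoc', div_lt_iff₀ (by positivity)]
    nlinarith
  have hsmall : ∀ x ∈ Icc s t, ∀ y ∈ Icc s t, x < y → y - x ≤ δ →
      g y - p y * m y < g x - p x * m x := by
    intro x hx y hy hxy hd
    have hxy' : Icc x y ⊆ Icc s t := Icc_subset_Icc hx.1 hy.2
    have hpxy : p y < p x := hp (hsub hx) (hsub hy) hxy
    have key := Convex.norm_image_sub_le_of_norm_hasDerivWithin_le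
      (f := fun z => g z - p y * m z) (f' := fun z => p z * m' z - p y * m' z)
      (C := (p x - p y) * K) (s := Icc x y)
      (fun z hz => ((hg z (hsub (hxy' hz))).sub
        ((hm z (hsub (hxy' hz))).const_mul (p y))).hasDerivWithinAt)
      (fun z hz => by
        rw [← sub_mul, norm_mul]
        have h1 : p z ≤ p x := hp.antitoneOn (hsub hx) (hsub (hxy' hz)) hz.1
        have h2 : p y ≤ p z := hp.antitoneOn (hsub (hxy' hz)) (hsub hy) hz.2
        have h3 : ‖p z - p y‖ ≤ p x - p y := by
          rw [Real.norm_eq_abs, abs_of_nonneg (by linarith)]; linarith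
        exact mul_le_mul h3 (hK z (hxy' hz)) (norm_nonneg _) (by linarith))
      (convex_Icc x y) (left_mem_Icc.2 hxy.le) (right_mem_Icc.2 hxy.le)
    rw [Real.norm_eq_abs, Real.norm_eq_abs, abs_of_pos (sub_pos.2 hxy)] at key
    have h4 := (abs_le.1 key).2
    have h5 : m x ≤ m x₀ := hmax hx
    have h6 : K * (y - x) ≤ K * δ := mul_le_mul_of_nonneg_left hd hK0
    have h7 : (p x - p y) * (K * (y - x) + m x) < 0 :=
      mul_neg_of_pos_of_neg (by linarith) (by linarith)
    nlinarith
  have hdouble : ∀ n : ℕ, ∀ x ∈ Icc s t, ∀ y ∈ Icc s t, x < y → y - x ≤ 2 ^ n * δ →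
      g y - p y * m y < g x - p x * m x := by
    intro n
    induction n with
    | zero => simpa using hsmall
    | succ n ih =>
      intro x hx y hy hxy hd
      rw [pow_succ] at hd
      have hz : (x + y) / 2 ∈ Icc s t := ⟨by linarith [hx.1, hy.1], by linarith [hx.2, hy.2]⟩
      exact (ih _ hz y hy (by linarith) (by linarith)).trans
        (ih x hx _ hz (by linarith) (by linarith))
  obtain ⟨n, hn⟩ := pow_unbounded_of_one_lt ((t - s) / δ) (one_lt_two : (1 : ℝ) < 2)
  rw [div_lt_iff₀ hδ] at hn
  exact hdouble n s (left_mem_Icc.2 hst.le) t (right_mem_Icc.2 hst.le) hst hn.le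

lemma CondF2.differentiableAt_of_pos {c : EReal} {f : ℝ → ℝ} (hf2 : CondF2 c f) {s : ℝ}
    (hs : 0 < s) (hsc : (s : EReal) < c) : DifferentiableAt ℝ f s := by
  have hopen : IsOpen {s : ℝ | 0 < s ∧ (s : EReal) < c} :=
    (isOpen_lt continuous_const continuous_id).inter
      (isOpen_lt continuous_coe_real_ereal continuous_const)
  exact (hf2.1.differentiableOn one_ne_zero).differentiableAt (hopen.mem_nhds ⟨hs, hsc⟩)

lemma CondF2.differentiableAt {c : EReal} {f : ℝ → ℝ} (hf2 : CondF2 c f)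
    (hodd : ∀ s, f (-s) = -f s) {s : ℝ} (hs : s ≠ 0) (hsc : InCC c s) :
    DifferentiableAt ℝ f s := by
  rcases hs.lt_or_gt with h | h
  · have h1 : DifferentiableAt ℝ f (-s) :=
      hf2.differentiableAt_of_pos (by linarith) hsc.neg.2
    have h2 : f = fun x => -f (-x) := by funext x; rw [hodd, neg_neg]
    rw [h2]
    exact (DifferentiableAt.comp s h1 differentiableAt_id.neg).neg
  · exact hf2.differentiableAt_of_pos h hsc.2

lemma deriv_neg_of_odd {f : ℝ → ℝ} (hodd : ∀ s, f (-s) = -f s) (s : ℝ) :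
    deriv f (-s) = deriv f s := by
  have h1 := deriv_comp_neg f s
  have h2 : (fun x => f (-x)) = fun x => -f x := funext hodd
  rw [h2, deriv.fun_neg] at h1
  linarith

lemma CondF1.exists_bound_nhds {c : EReal} {f : ℝ → ℝ} {b β : ℝ} (hf1 : CondF1 c f b β)
    (hf2 : CondF2 c f) {s₀ : ℝ} (hs₀ : InCC c s₀) : ∃ N, ∀ᶠ s in 𝓝 s₀, |f s| ≤ N := by
  obtain ⟨hodd, hf0, hb, hbβ, hβ, -⟩ := hf1
  by_cases h0 : s₀ = 0
  · subst h0
    obtain ⟨d, hd0, hd1, hdβ⟩ : ∃ d : ℝ, 0 < d ∧ d < 1 ∧ d ≤ β :=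
      ⟨min β (1 / 2), lt_min (hb.trans hbβ) (by norm_num),
        (min_le_right _ _).trans_lt (by norm_num), min_le_left _ _⟩
    have hdc : ∀ s ≤ d, (s : EReal) < c := fun s hs =>
      lt_of_le_of_lt (EReal.coe_le_coe_iff.2 (hs.trans hdβ)) hβ
    have hpos : ∀ s, 0 < s → s ≤ d → |f s| ≤ |f d| + ∫ x in Ioo (0 : ℝ) 1, ‖deriv f x‖ := by
      intro s hs hsd
      have hsub : Ioc s d ⊆ Ioo 0 1 := fun x hx => ⟨hs.trans hx.1, hx.2.trans_lt hd1⟩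
      have hint : IntegrableOn (deriv f) (Ioc s d) := hf2.2.mono_set hsub
      have hftc := intervalIntegral.integral_eq_sub_of_hasDerivAt (f := f) (f' := deriv f)
        (a := s) (b := d)
        (fun x hx => by
          rw [uIcc_of_le hsd] at hx
          exact (hf2.differentiableAt_of_pos (hs.trans_le hx.1) (hdc x hx.2)).hasDerivAt)
        ((intervalIntegrable_iff_integrableOn_Ioc_of_le hsd).2 hint)
      rw [intervalIntegral.integral_of_le hsd] at hftc
      have h1 : ‖∫ x in Ioc s d, deriv f x‖ ≤ ∫ x in Ioo (0 : ℝ) 1, ‖deriv f x‖ :=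
        (norm_integral_le_integral_norm _).trans
          (setIntegral_mono_set hf2.2.norm (Eventually.of_forall fun _ => norm_nonneg _)
            hsub.eventuallyLE)
      rw [hftc, Real.norm_eq_abs] at h1
      have h2 := abs_sub_abs_le_abs_sub (f s) (f d)
      rw [abs_sub_comm] at h2
      linarith
    refine ⟨|f d| + ∫ x in Ioo (0 : ℝ) 1, ‖deriv f x‖, ?_⟩
    filter_upwards [Icc_mem_nhds (neg_lt_zero.2 hd0) hd0] with s hs
    rcases lt_trichotomy s 0 with h | h | h
    · have := hpos (-s) (by linarith) (by linarith [hs.1])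
      rwa [hodd, abs_neg] at this
    · subst h
      rw [hf0, abs_zero]
      exact (abs_nonneg _).trans (hpos d hd0 le_rfl)
    · exact hpos s h hs.2
  · have hc := (hf2.differentiableAt hodd h0 hs₀).continuousAt.abs
    exact ⟨|f s₀| + 1, (hc.eventually_lt continuousAt_const (by simp)).mono fun _ h => h.le⟩

lemma CondQ1.hasDerivAt {q : ℝ → ℝ} (hq1 : CondQ1 q) {r : ℝ} (hr : 0 < r) :
    HasDerivAt q (deriv q r) r :=
  ((hq1.1.differentiableOn one_ne_zero).differentiableAt (Ioi_mem_nhds hr)).hasDerivAt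

lemma CondQ1.monotoneOn {q : ℝ → ℝ} (hq1 : CondQ1 q) : MonotoneOn q (Ioi 0) :=
  monotoneOn_of_deriv_nonneg (convex_Ioi 0) hq1.1.continuousOn
    (by rw [interior_Ioi]; exact hq1.1.differentiableOn one_ne_zero)
    (by rw [interior_Ioi]; exact fun x hx => (hq1.2.1 x hx).2.le)

lemma IsSolutionE.hasDerivAt_deriv {c : EReal} {f q u : ℝ → ℝ} (hu : IsSolutionE c f q u)
    {r : ℝ} (hr : 0 < r) :
    HasDerivAt (deriv u) (-(deriv q r / q r) * deriv u r - f (u r)) r := by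
  have h := (hu.diff2 r hr).hasDerivAt
  rwa [show deriv (deriv u) r = -(deriv q r / q r) * deriv u r - f (u r) by
    linarith [hu.ode r hr]] at h

lemma exists_abs_deriv_le_of_contDiffOn_Ici {w : ℝ → ℝ} (hw : ContDiffOn ℝ 1 w (Ici 0))
    (R : ℝ) : ∃ C, ∀ r, 0 < r → r ≤ R → |deriv w r| ≤ C := by
  have hcont : ContinuousOn (derivWithin w (Ici 0)) (Icc 0 R) :=
    (hw.continuousOn_derivWithin (uniqueDiffOn_Ici 0) le_rfl).mono Icc_subset_Ici_self
  obtain ⟨C, hC⟩ := isCompact_Icc.exists_bound_of_continuousOn hcont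
  refine ⟨C, fun r hr hrR => ?_⟩
  rw [← derivWithin_of_mem_nhds (Ici_mem_nhds hr)]
  exact hC r ⟨hr.le, hrR⟩

lemma IsSolutionE.tendsto_deriv_zero {c : EReal} {f q u : ℝ → ℝ} {b β : ℝ}
    (hf1 : CondF1 c f b β) (hf2 : CondF2 c f) (hq1 : CondQ1 q) (hu : IsSolutionE c f q u) :
    Tendsto (deriv u) (𝓝[>] 0) (𝓝 0) := by
  obtain ⟨N, hN⟩ := hf1.exists_bound_nhds hf2 (hu.mem 0 le_rfl)
  have hucont : Tendsto u (𝓝[>] 0) (𝓝 (u 0)) :=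
    (hu.c1.continuousOn 0 self_mem_Ici).mono_left (nhdsWithin_mono _ Ioi_subset_Ici_self)
  obtain ⟨ρ, hρ0, hρ⟩ := mem_nhdsGT_iff_exists_Ioo_subset.1 (hucont.eventually hN)
  obtain ⟨C, hC⟩ := exists_abs_deriv_le_of_contDiffOn_Ici hu.c1 ρ
  have hqlim : Tendsto q (𝓝[>] 0) (𝓝 0) := by
    have := hq1.2.2.2.mono_left (nhdsWithin_mono _ Ioi_subset_Ici_self)
    rwa [hq1.2.2.1] at this
  have hqu : Tendsto (fun r => q r * deriv u r) (𝓝[>] 0) (𝓝 0) := by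
    have hb : Tendsto (fun r => |q r| * C) (𝓝[>] 0) (𝓝 0) := by simpa using hqlim.abs.mul_const C
    refine squeeze_zero_norm' ?_ hb
    filter_upwards [Ioo_mem_nhdsGT hρ0] with r hr
    rw [norm_mul, Real.norm_eq_abs, Real.norm_eq_abs]
    exact mul_le_mul_of_nonneg_left (hC r hr.1 hr.2.le) (abs_nonneg _)
  have hbound : ∀ r ∈ Ioo 0 ρ, |deriv u r| ≤ N * r := by
    intro r hr
    have hqr : 0 < q r := (hq1.2.1 r hr.1).1
    have hN0 : 0 ≤ N := (abs_nonneg _).trans (hρ hr)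
    have hinc : ∀ s ∈ Ioo 0 r, |q r * deriv u r - q s * deriv u s| ≤ N * q r * r := by
      intro s hs
      have key := Convex.norm_image_sub_le_of_norm_hasDerivWithin_le
        (f := fun x => q x * deriv u x) (f' := fun x => -(q x * f (u x)))
        (C := N * q r) (s := Icc s r)
        (fun x hx => by
          have hx0 : 0 < x := hs.1.trans_le hx.1
          have hqx : q x ≠ 0 := (hq1.2.1 x hx0).1.ne'
          have h := (hq1.hasDerivAt hx0).mul (hu.hasDerivAt_deriv hx0)
          refine (h.congr_deriv ?_).hasDerivWithinAt
          field_simp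
          ring)
        (fun x hx => by
          have hx0 : 0 < x := hs.1.trans_le hx.1
          rw [norm_neg, norm_mul, mul_comm, Real.norm_eq_abs, Real.norm_eq_abs,
            abs_of_pos (hq1.2.1 x hx0).1]
          exact mul_le_mul (hρ ⟨hx0, hx.2.trans_lt hr.2⟩)
            (hq1.monotoneOn hx0 hr.1 hx.2) (hq1.2.1 x hx0).1.le hN0)
        (convex_Icc s r) (left_mem_Icc.2 hs.2.le) (right_mem_Icc.2 hs.2.le)
      refine key.trans ?_
      rw [Real.norm_eq_abs, abs_of_pos (sub_pos.2 hs.2)]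
      exact mul_le_mul_of_nonneg_left (by linarith [hs.1]) (by positivity)
    have hlim : Tendsto (fun s => |q r * deriv u r - q s * deriv u s|) (𝓝[>] 0)
        (𝓝 |q r * deriv u r - 0|) := (hqu.const_sub _).abs
    have h := le_of_tendsto hlim (by filter_upwards [Ioo_mem_nhdsGT hr.1] with s hs using hinc s hs)
    rw [sub_zero, abs_mul, abs_of_pos hqr] at h
    exact le_of_mul_le_mul_left (by linarith) hqr
  have hNr : Tendsto (fun r : ℝ => N * r) (𝓝[>] 0) (𝓝 0) := by
    have : Tendsto (fun r : ℝ => N * r) (𝓝 0) (𝓝 (N * 0)) := tendsto_id.const_mul N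
    rw [mul_zero] at this
    exact this.mono_left nhdsWithin_le_nhds
  refine squeeze_zero_norm' ?_ hNr
  filter_upwards [Ioo_mem_nhdsGT hρ0] with r hr using hbound r hr

lemma forall_neg_or_forall_pos_of_ne_zero {v v' : ℝ → ℝ} {a b : ℝ}
    (hv : ∀ x ∈ Ioo a b, HasDerivAt v (v' x) x) (hne : ∀ x ∈ Ioo a b, v x ≠ 0) :
    (∀ x ∈ Ioo a b, v x < 0) ∨ ∀ x ∈ Ioo a b, 0 < v x := by
  have hcont : ContinuousOn v (Ioo a b) :=
    fun x hx => (hv x hx).continuousAt.continuousWithinAt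
  by_contra! h
  obtain ⟨⟨x, hx, hx0⟩, y, hy, hy0⟩ := h
  obtain ⟨z, hz, hz0⟩ := isPreconnected_Ioo.intermediate_value hy hx hcont ⟨hy0, hx0⟩
  exact hne z hz hz0

lemma exists_Ioo_deriv_nonpos_right {v v' : ℝ → ℝ} {a b : ℝ}
    (hv : ∀ x ∈ Ioo a b, HasDerivAt v (v' x) x) (hlim : Tendsto v (𝓝[>] a) (𝓝 0))
    (hneg : ∀ x ∈ Ioo a b, v x < 0) {t : ℝ} (ht : t ∈ Ioo a b) : ∃ x ∈ Ioo a t, v' x ≤ 0 := by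
  by_contra! h
  have hmono : MonotoneOn v (Ioo a t) :=
    monotoneOn_of_hasDerivWithinAt_nonneg (convex_Ioo a t)
      (fun x hx => (hv x ⟨hx.1, hx.2.trans ht.2⟩).continuousAt.continuousWithinAt)
      (by
        rw [interior_Ioo]
        exact fun x hx => (hv x ⟨hx.1, hx.2.trans ht.2⟩).hasDerivWithinAt)
      (by rw [interior_Ioo]; exact fun x hx => (h x hx).le)
  obtain ⟨s, hs⟩ := nonempty_Ioo.2 ht.1
  have h0 : 0 ≤ v s := le_of_tendsto hlim (by
    filter_upwards [Ioo_mem_nhdsGT hs.1] with x hx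
    exact hmono ⟨hx.1, hx.2.trans hs.2⟩ hs hx.2.le)
  exact absurd (hneg s ⟨hs.1, hs.2.trans ht.2⟩) h0.not_gt

lemma exists_Ioo_deriv_nonneg_left {v v' : ℝ → ℝ} {a b : ℝ}
    (hv : ∀ x ∈ Ioo a b, HasDerivAt v (v' x) x) (hlim : Tendsto v (𝓝[<] b) (𝓝 0))
    (hneg : ∀ x ∈ Ioo a b, v x < 0) {t : ℝ} (ht : t ∈ Ioo a b) : ∃ x ∈ Ioo t b, 0 ≤ v' x := by
  by_contra! h
  have hanti : AntitoneOn v (Ioo t b) :=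
    antitoneOn_of_hasDerivWithinAt_nonpos (convex_Ioo t b)
      (fun x hx => (hv x ⟨ht.1.trans hx.1, hx.2⟩).continuousAt.continuousWithinAt)
      (by
        rw [interior_Ioo]
        exact fun x hx => (hv x ⟨ht.1.trans hx.1, hx.2⟩).hasDerivWithinAt)
      (by rw [interior_Ioo]; exact fun x hx => (h x hx).le)
  obtain ⟨s, hs⟩ := nonempty_Ioo.2 ht.2
  have h0 : 0 ≤ v s := le_of_tendsto hlim (by
    filter_upwards [Ioo_mem_nhdsLT hs.2] with x hx
    exact hanti hs ⟨hs.1.trans hx.1, hx.2⟩ hx.1.le)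
  exact absurd (hneg s ⟨ht.1.trans hs.1, hs.2⟩) h0.not_gt

/-- The Wronskian-type quantity `q (v' φ - v ψ)` for `v = u'` and `ψ = φ'`, with `v'` eliminated
through (E). -/
def variationWronskian (f q u v φ ψ : ℝ → ℝ) (r : ℝ) : ℝ :=
  -(q r * f (u r) * φ r) - q r * v r * ψ r - deriv q r / q r * (q r * v r * φ r)

section Wronskian

variable {c : EReal} {f q u v φ ψ : ℝ → ℝ} {b β r₁ r₂ : ℝ}

lemma strictAntiOn_variationWronskian_of_ne_zero
    (hf1 : CondF1 c f b β) (hf2 : CondF2 c f) (hq1 : CondQ1 q) (hq2 : CondQ2 q)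
    (hr₁ : 0 ≤ r₁)
    (hmem : ∀ r ∈ Ioo r₁ r₂, InCC c (u r))
    (hu : ∀ r ∈ Ioo r₁ r₂, HasDerivAt u (v r) r)
    (hv : ∀ r ∈ Ioo r₁ r₂, HasDerivAt v (-(deriv q r / q r) * v r - f (u r)) r)
    (hφ : ∀ r ∈ Ioo r₁ r₂, HasDerivAt φ (ψ r) r)
    (hψ : ∀ r ∈ Ioo r₁ r₂, u r ≠ 0 →
      HasDerivAt ψ (-(deriv q r / q r) * ψ r - deriv f (u r) * φ r) r)
    (hneg : ∀ r ∈ Ioo r₁ r₂, v r < 0) (hpos : ∀ r ∈ Ioo r₁ r₂, 0 < φ r)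
    (hu0 : ∀ r ∈ Ioo r₁ r₂, u r ≠ 0) :
    StrictAntiOn (variationWronskian f q u v φ ψ) (Ioo r₁ r₂) := by
  have h0 : ∀ r ∈ Ioo r₁ r₂, 0 < r := fun r hr => hr₁.trans_lt hr.1
  have hfu : ∀ r ∈ Ioo r₁ r₂, HasDerivAt (fun r => f (u r)) (deriv f (u r) * v r) r :=
    fun r hr => (hf2.differentiableAt hf1.1 (hu0 r hr) (hmem r hr)).hasDerivAt.comp r (hu r hr)
  refine strictAntiOn_sub_mul_of_hasDerivAt (p := fun r => deriv q r / q r)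
    (g := fun r => -(q r * f (u r) * φ r) - q r * v r * ψ r)
    (m := fun r => q r * v r * φ r)
    (m' := fun r => -(q r * f (u r) * φ r) + q r * v r * ψ r) ?_ ?_ ?_ ?_ ?_
  · intro r hr
    have hqr : q r ≠ 0 := (hq1.2.1 r (h0 r hr)).1.ne'
    have hq := hq1.hasDerivAt (h0 r hr)
    refine ((((hq.mul (hfu r hr)).mul (hφ r hr)).neg).sub
      ((hq.mul (hv r hr)).mul (hψ r hr (hu0 r hr)))).congr_deriv ?_
    simp only [Pi.mul_apply]
    field_simp
    ring
  · intro r hr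
    have hqr : q r ≠ 0 := (hq1.2.1 r (h0 r hr)).1.ne'
    refine (((hq1.hasDerivAt (h0 r hr)).mul (hv r hr)).mul (hφ r hr)).congr_deriv ?_
    simp only [Pi.mul_apply]
    field_simp
    ring
  · intro r hr
    have hq := (hq1.hasDerivAt (h0 r hr)).continuousAt
    exact (((hq.mul (hfu r hr).continuousAt).mul (hφ r hr).continuousAt).neg.add
      ((hq.mul (hv r hr).continuousAt).mul
        (hψ r hr (hu0 r hr)).continuousAt)).continuousWithinAt
  · exact hq2.mono fun r hr => h0 r hr
  · exact fun r hr => mul_neg_of_neg_of_pos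
      (mul_neg_of_pos_of_neg (hq1.2.1 r (h0 r hr)).1 (hneg r hr)) (hpos r hr)

lemma strictAntiOn_variationWronskian
    (hf1 : CondF1 c f b β) (hf2 : CondF2 c f) (hq1 : CondQ1 q) (hq2 : CondQ2 q)
    (hr₁ : 0 ≤ r₁)
    (hmem : ∀ r ∈ Ioo r₁ r₂, InCC c (u r))
    (hu : ∀ r ∈ Ioo r₁ r₂, HasDerivAt u (v r) r)
    (hv : ∀ r ∈ Ioo r₁ r₂, HasDerivAt v (-(deriv q r / q r) * v r - f (u r)) r)
    (hφ : ∀ r ∈ Ioo r₁ r₂, HasDerivAt φ (ψ r) r)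
    (hψc : ContinuousOn ψ (Ioo r₁ r₂))
    (hψ : ∀ r ∈ Ioo r₁ r₂, u r ≠ 0 →
      HasDerivAt ψ (-(deriv q r / q r) * ψ r - deriv f (u r) * φ r) r)
    (hneg : ∀ r ∈ Ioo r₁ r₂, v r < 0) (hpos : ∀ r ∈ Ioo r₁ r₂, 0 < φ r) :
    StrictAntiOn (variationWronskian f q u v φ ψ) (Ioo r₁ r₂) := by
  have huanti : StrictAntiOn u (Ioo r₁ r₂) :=
    strictAntiOn_of_hasDerivWithinAt_neg (f' := v) (convex_Ioo r₁ r₂)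
      (fun x hx => (hu x hx).continuousAt.continuousWithinAt)
      (by rw [interior_Ioo]; exact fun x hx => (hu x hx).hasDerivWithinAt)
      (by rw [interior_Ioo]; exact hneg)
  by_cases hz : ∀ r ∈ Ioo r₁ r₂, u r ≠ 0
  · exact strictAntiOn_variationWronskian_of_ne_zero hf1 hf2 hq1 hq2 hr₁ hmem hu hv hφ hψ
      hneg hpos hz
  push Not at hz
  obtain ⟨z, hzI, huz⟩ := hz
  have hz0 : 0 < z := hr₁.trans_lt hzI.1
  have hsubl : Ioo r₁ z ⊆ Ioo r₁ r₂ := Ioo_subset_Ioo_right hzI.2.le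
  have hsubr : Ioo z r₂ ⊆ Ioo r₁ r₂ := Ioo_subset_Ioo_left hzI.1.le
  have hleft : StrictAntiOn (variationWronskian f q u v φ ψ) (Ioo r₁ z) :=
    strictAntiOn_variationWronskian_of_ne_zero hf1 hf2 hq1 hq2 hr₁
      (fun r hr => hmem r (hsubl hr)) (fun r hr => hu r (hsubl hr)) (fun r hr => hv r (hsubl hr))
      (fun r hr => hφ r (hsubl hr)) (fun r hr => hψ r (hsubl hr))
      (fun r hr => hneg r (hsubl hr)) (fun r hr => hpos r (hsubl hr))
      (fun r hr h => (huanti (hsubl hr) hzI hr.2).ne' (h.trans huz.symm))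
  have hright : StrictAntiOn (variationWronskian f q u v φ ψ) (Ioo z r₂) :=
    strictAntiOn_variationWronskian_of_ne_zero hf1 hf2 hq1 hq2 hz0.le
      (fun r hr => hmem r (hsubr hr)) (fun r hr => hu r (hsubr hr)) (fun r hr => hv r (hsubr hr))
      (fun r hr => hφ r (hsubr hr)) (fun r hr => hψ r (hsubr hr))
      (fun r hr => hneg r (hsubr hr)) (fun r hr => hpos r (hsubr hr))
      (fun r hr h => (huanti hzI (hsubr hr) hr.1).ne (h.trans huz.symm))
  set W := variationWronskian f q u v φ ψ with hW
  let V : ℝ → ℝ := fun r => - (q r * v r * ψ r) - deriv q r / q r * (q r * v r * φ r)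
  have hWV : ∀ r, W r = -(q r * f (u r) * φ r) + V r := fun r => by
    simp only [hW, variationWronskian, V]; ring
  have hWz : W z = V z := by rw [hWV, huz, hf1.2.1]; ring
  have hVlim : Tendsto V (𝓝 z) (𝓝 (V z)) := by
    have hq := (hq1.hasDerivAt hz0).continuousAt
    have hq' : ContinuousAt (deriv q) z :=
      (hq1.1.continuousOn_deriv_of_isOpen isOpen_Ioi le_rfl).continuousAt (Ioi_mem_nhds hz0)
    have hv' := (hv z hzI).continuousAt
    exact ((hq.mul hv').mul (hψc.continuousAt (Ioo_mem_nhds hzI.1 hzI.2))).neg.sub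
      ((hq'.div hq (hq1.2.1 z hz0).1.ne').mul ((hq.mul hv').mul (hφ z hzI).continuousAt))
  obtain ⟨hodd, hf0, hb, -, -, -, hfb, -⟩ := hf1
  have hucont : Tendsto u (𝓝 z) (𝓝 0) := huz ▸ (hu z hzI).continuousAt
  have hun : ∀ᶠ r in 𝓝 z, u r ∈ Icc (-b) b :=
    hucont (Icc_mem_nhds (neg_lt_zero.2 hb) hb)
  have hzle : ∀ s ∈ Ioo r₁ z, W z ≤ W s := by
    intro s hs
    rw [hWz]
    refine le_of_tendsto (hVlim.mono_left (nhdsWithin_le_nhds (s := Iio z))) ?_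
    filter_upwards [hun.filter_mono nhdsWithin_le_nhds, Ioo_mem_nhdsLT hs.2] with t htu ht
    have htl : t ∈ Ioo r₁ z := ⟨hs.1.trans ht.1, ht.2⟩
    have h1 : f (u t) ≤ 0 := hfb _ ⟨huz ▸ (huanti (hsubl htl) hzI ht.2).le, htu.2⟩
    have h2 : 0 < q t * φ t :=
      mul_pos (hq1.2.1 t (hr₁.trans_lt htl.1)).1 (hpos t (hsubl htl))
    have h3 := hleft hs htl ht.1
    rw [hWV t] at h3
    nlinarith [mul_nonneg h2.le (neg_nonneg.2 h1)]
  have hlez : ∀ s ∈ Ioo z r₂, W s ≤ W z := by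
    intro s hs
    rw [hWz]
    refine ge_of_tendsto (hVlim.mono_left (nhdsWithin_le_nhds (s := Ioi z))) ?_
    filter_upwards [hun.filter_mono nhdsWithin_le_nhds, Ioo_mem_nhdsGT hs.1] with t htu ht
    have htr : t ∈ Ioo z r₂ := ⟨ht.1, ht.2.trans hs.2⟩
    have hut : u t ≤ 0 := huz ▸ (huanti hzI (hsubr htr) ht.1).le
    have h1 : f (-u t) ≤ 0 := hfb _ ⟨by linarith, by linarith [htu.1]⟩
    rw [hodd] at h1
    have h2 : 0 < q t * φ t := mul_pos (hq1.2.1 t (hz0.trans ht.1)).1 (hpos t (hsubr htr))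
    have h3 := hright htr hs ht.2
    rw [hWV t] at h3
    nlinarith [mul_nonneg h2.le (neg_nonneg.2 h1)]
  have hleft' : ∀ s ∈ Ioo r₁ z, W z < W s := fun s hs => by
    obtain ⟨t, ht⟩ := nonempty_Ioo.2 hs.2
    have htl : t ∈ Ioo r₁ z := ⟨hs.1.trans ht.1, ht.2⟩
    exact (hzle t htl).trans_lt (hleft hs htl ht.1)
  have hright' : ∀ s ∈ Ioo z r₂, W s < W z := fun s hs => by
    obtain ⟨t, ht⟩ := nonempty_Ioo.2 hs.1
    have htr : t ∈ Ioo z r₂ := ⟨ht.1, ht.2.trans hs.2⟩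
    exact (hright htr hs ht.2).trans_le (hlez t htr)
  intro s hs t ht hst
  rcases lt_trichotomy s z with h | h | h
  · rcases lt_trichotomy t z with h' | h' | h'
    · exact hleft ⟨hs.1, h⟩ ⟨ht.1, h'⟩ hst
    · exact h' ▸ hleft' s ⟨hs.1, h⟩
    · exact (hright' t ⟨h', ht.2⟩).trans (hleft' s ⟨hs.1, h⟩)
  · exact h ▸ hright' t ⟨h ▸ hst, ht.2⟩
  · exact hright ⟨h, hs.2⟩ ⟨h.trans hst, ht.2⟩ hst

lemma not_pos_variation_of_decreasing
    (hf1 : CondF1 c f b β) (hf2 : CondF2 c f) (hq1 : CondQ1 q) (hq2 : CondQ2 q)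
    (hr₁ : 0 ≤ r₁) (hr₁₂ : r₁ < r₂)
    (hmem : ∀ r ∈ Ioo r₁ r₂, InCC c (u r))
    (hu : ∀ r ∈ Ioo r₁ r₂, HasDerivAt u (v r) r)
    (hv : ∀ r ∈ Ioo r₁ r₂, HasDerivAt v (-(deriv q r / q r) * v r - f (u r)) r)
    (hv₁ : Tendsto v (𝓝[>] r₁) (𝓝 0)) (hv₂ : Tendsto v (𝓝[<] r₂) (𝓝 0))
    (hφ : ∀ r ∈ Ioo r₁ r₂, HasDerivAt φ (ψ r) r)
    (hψc : ContinuousOn ψ (Ioo r₁ r₂))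
    (hψb : ∃ C, ∀ r ∈ Ioo r₁ r₂, |ψ r| ≤ C)
    (hψ : ∀ r ∈ Ioo r₁ r₂, u r ≠ 0 →
      HasDerivAt ψ (-(deriv q r / q r) * ψ r - deriv f (u r) * φ r) r)
    (hneg : ∀ r ∈ Ioo r₁ r₂, v r < 0) (hpos : ∀ r ∈ Ioo r₁ r₂, 0 < φ r) : False := by
  have hanti := strictAntiOn_variationWronskian hf1 hf2 hq1 hq2 hr₁ hmem hu hv hφ hψc hψ
    hneg hpos
  set W := variationWronskian f q u v φ ψ with hW
  obtain ⟨C, hC⟩ := hψb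
  have hr₂ : 0 < r₂ := hr₁.trans_lt hr₁₂
  have hqpos : ∀ r ∈ Ioo r₁ r₂, 0 < q r := fun r hr => (hq1.2.1 r (hr₁.trans_lt hr.1)).1
  have hWeq : ∀ r ∈ Ioo r₁ r₂,
      W r = q r * φ r * (-(deriv q r / q r) * v r - f (u r)) - q r * v r * ψ r := fun r _ => by
    simp only [hW, variationWronskian]; ring
  have hsmall : ∀ r ∈ Ioo r₁ r₂, |q r * v r * ψ r| ≤ q r₂ * C * |v r| := fun r hr => by
    have hC0 : 0 ≤ C := (abs_nonneg _).trans (hC r hr)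
    rw [abs_mul, abs_mul, abs_of_pos (hqpos r hr), mul_right_comm]
    have := hq1.monotoneOn (hr₁.trans_lt hr.1) hr₂ hr.2.le
    have := mul_le_mul this (hC r hr) (abs_nonneg _) ((hqpos r hr).le.trans this)
    exact mul_le_mul_of_nonneg_right this (abs_nonneg _)
  have hlim : ∀ {l : Filter ℝ}, Tendsto v l (𝓝 0) →
      Tendsto (fun r => q r₂ * C * |v r|) l (𝓝 0) := fun h => by
    simpa using (h.abs.const_mul (q r₂ * C))
  have hle : ∀ s ∈ Ioo r₁ r₂, W s ≤ 0 := by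
    intro s hs
    by_contra! hWs
    obtain ⟨a, ha, haW⟩ := mem_nhdsGT_iff_exists_Ioo_subset.1 ((hlim hv₁).eventually_lt_const hWs)
    have hmin : min a s ∈ Ioo r₁ r₂ := ⟨lt_min ha hs.1, (min_le_right _ _).trans_lt hs.2⟩
    obtain ⟨x, hx, hvx⟩ := exists_Ioo_deriv_nonpos_right hv hv₁ hneg hmin
    have hxs : x < s := hx.2.trans_le (min_le_right _ _)
    have hxI : x ∈ Ioo r₁ r₂ := ⟨hx.1, hxs.trans hs.2⟩
    have h1 : q r₂ * C * |v x| < W s := haW ⟨hx.1, hx.2.trans_le (min_le_left _ _)⟩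
    have h2 := hanti hxI hs hxs
    have h3 := (abs_le.1 (hsmall x hxI)).1
    have h4 := mul_nonneg (mul_pos (hqpos x hxI) (hpos x hxI)).le (neg_nonneg.2 hvx)
    rw [hWeq x hxI] at h2
    linarith
  have hge : ∀ s ∈ Ioo r₁ r₂, 0 ≤ W s := by
    intro s hs
    by_contra! hWs
    obtain ⟨a, ha, haW⟩ := mem_nhdsLT_iff_exists_Ioo_subset.1
      ((hlim hv₂).eventually_lt_const (neg_pos.2 hWs))
    have hmax : max a s ∈ Ioo r₁ r₂ := ⟨hs.1.trans_le (le_max_right _ _), max_lt ha hs.2⟩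
    obtain ⟨x, hx, hvx⟩ := exists_Ioo_deriv_nonneg_left hv hv₂ hneg hmax
    have hxs : s < x := (le_max_right _ _).trans_lt hx.1
    have hxI : x ∈ Ioo r₁ r₂ := ⟨hs.1.trans hxs, hx.2⟩
    have h1 : q r₂ * C * |v x| < -W s := haW ⟨(le_max_left _ _).trans_lt hx.1, hx.2⟩
    have h2 := hanti hs hxI hxs
    have h3 := (abs_le.1 (hsmall x hxI)).2
    have h4 := mul_nonneg (mul_pos (hqpos x hxI) (hpos x hxI)).le hvx
    rw [hWeq x hxI] at h2
    linarith
  obtain ⟨s, hs⟩ := nonempty_Ioo.2 hr₁₂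
  obtain ⟨t, ht⟩ := nonempty_Ioo.2 hs.2
  have htI : t ∈ Ioo r₁ r₂ := ⟨hs.1.trans ht.1, ht.2⟩
  exact (((hge t htI).trans_lt (hanti hs htI ht.1)).trans_le (hle s hs)).false

lemma not_pos_variation
    (hf1 : CondF1 c f b β) (hf2 : CondF2 c f) (hq1 : CondQ1 q) (hq2 : CondQ2 q)
    (hr₁ : 0 ≤ r₁) (hr₁₂ : r₁ < r₂)
    (hmem : ∀ r ∈ Ioo r₁ r₂, InCC c (u r))
    (hu : ∀ r ∈ Ioo r₁ r₂, HasDerivAt u (v r) r)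
    (hv : ∀ r ∈ Ioo r₁ r₂, HasDerivAt v (-(deriv q r / q r) * v r - f (u r)) r)
    (hv₁ : Tendsto v (𝓝[>] r₁) (𝓝 0)) (hv₂ : Tendsto v (𝓝[<] r₂) (𝓝 0))
    (hφ : ∀ r ∈ Ioo r₁ r₂, HasDerivAt φ (ψ r) r)
    (hψc : ContinuousOn ψ (Ioo r₁ r₂))
    (hψb : ∃ C, ∀ r ∈ Ioo r₁ r₂, |ψ r| ≤ C)
    (hψ : ∀ r ∈ Ioo r₁ r₂, u r ≠ 0 →
      HasDerivAt ψ (-(deriv q r / q r) * ψ r - deriv f (u r) * φ r) r)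
    (hne : ∀ r ∈ Ioo r₁ r₂, v r ≠ 0) (hpos : ∀ r ∈ Ioo r₁ r₂, 0 < φ r) : False := by
  rcases forall_neg_or_forall_pos_of_ne_zero hv hne with hneg | hvpos
  · exact not_pos_variation_of_decreasing hf1 hf2 hq1 hq2 hr₁ hr₁₂ hmem hu hv hv₁ hv₂ hφ hψc hψb
      hψ hneg hpos
  · refine not_pos_variation_of_decreasing (u := fun r => -u r) (v := fun r => -v r) hf1 hf2 hq1
      hq2 hr₁ hr₁₂ (fun r hr => (hmem r hr).neg) (fun r hr => (hu r hr).neg)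
      (fun r hr => (hv r hr).neg.congr_deriv ?_) (by simpa using hv₁.neg) (by simpa using hv₂.neg)
      hφ hψc hψb (fun r hr h => ?_) (fun r hr => neg_neg_of_pos (hvpos r hr)) hpos
    · rw [hf1.1]; ring
    · rw [deriv_neg_of_odd hf1.1]
      exact hψ r hr (neg_ne_zero.1 h)

end Wronskian

/-- Between two consecutive zeros of `u'`, the first variation `φ`
vanishes at some point of `(r₁, r₂]`. -/
theorem variation_zero_between_critical_points
    (c : EReal) (f q : ℝ → ℝ) (b β : ℝ) (hc : 0 < c)
    (hf1 : CondF1 c f b β) (hf2 : CondF2 c f)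
    (hq1 : CondQ1 q) (hq2 : CondQ2 q)
    (u φ : ℝ → ℝ) (hu : IsSolutionE c f q u)
    (hφ : IsFirstVariation c f q u φ)
    (r₁ r₂ : ℝ) (h0r₁ : 0 ≤ r₁) (hr₁₂ : r₁ < r₂)
    (hz₁ : deriv u r₁ = 0) (hz₂ : deriv u r₂ = 0)
    (hcons : ∀ r ∈ Ioo r₁ r₂, deriv u r ≠ 0) :
    ∃ r ∈ Ioc r₁ r₂, φ r = 0 := by
  have h0 : ∀ r ∈ Ioo r₁ r₂, 0 < r := fun r hr => h0r₁.trans_lt hr.1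
  have hr₂ : 0 < r₂ := h0r₁.trans_lt hr₁₂
  have hu' : ∀ r ∈ Ioo r₁ r₂, HasDerivAt u (deriv u r) r := fun r hr => hu.hasDerivAt (h0 r hr)
  have hv := fun r (hr : r ∈ Ioo r₁ r₂) => hu.hasDerivAt_deriv (h0 r hr)
  have hv₁ : Tendsto (deriv u) (𝓝[>] r₁) (𝓝 0) := by
    rcases h0r₁.eq_or_lt with h | h
    · exact h ▸ hu.tendsto_deriv_zero hf1 hf2 hq1
    · exact hz₁ ▸ (hu.diff2 r₁ h).continuousAt.continuousWithinAt.tendsto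
  have hv₂ : Tendsto (deriv u) (𝓝[<] r₂) (𝓝 0) :=
    hz₂ ▸ (hu.diff2 r₂ hr₂).continuousAt.continuousWithinAt.tendsto
  have hmem : ∀ r ∈ Ioo r₁ r₂, InCC c (u r) := fun r hr => hu.mem r (h0 r hr).le
  have hφ' : ∀ r ∈ Ioo r₁ r₂, HasDerivAt φ (deriv φ r) r := fun r hr =>
    ((hφ.c1.differentiableOn one_ne_zero).differentiableAt (Ici_mem_nhds (h0 r hr))).hasDerivAt
  have hψc : ContinuousOn (deriv φ) (Ioo r₁ r₂) :=
    ((hφ.c1.mono Ioi_subset_Ici_self).continuousOn_deriv_of_isOpen isOpen_Ioi le_rfl).mono h0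
  have hψ : ∀ r ∈ Ioo r₁ r₂, u r ≠ 0 →
      HasDerivAt (deriv φ) (-(deriv q r / q r) * deriv φ r - deriv f (u r) * φ r) r :=
    fun r hr hur => (hφ.diff2 r (h0 r hr) hur).hasDerivAt.congr_deriv
      (by linarith [hφ.ode r (h0 r hr) hur])
  obtain ⟨C, hC⟩ := exists_abs_deriv_le_of_contDiffOn_Ici hφ.c1 r₂
  have hψb : ∀ r ∈ Ioo r₁ r₂, |deriv φ r| ≤ C := fun r hr => hC r (h0 r hr) hr.2.le
  by_contra! hne
  rcases forall_neg_or_forall_pos_of_ne_zero hφ' (fun r hr => hne r (Ioo_subset_Ioc_self hr))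
    with hneg | hpos
  · refine not_pos_variation (φ := fun r => -φ r) (ψ := fun r => -deriv φ r) hf1 hf2 hq1 hq2 h0r₁
      hr₁₂ hmem hu' hv hv₁ hv₂ (fun r hr => (hφ' r hr).neg) hψc.neg
      ⟨C, fun r hr => by rw [abs_neg]; exact hψb r hr⟩
      (fun r hr hur => (hψ r hr hur).neg.congr_deriv (by ring)) hcons
      (fun r hr => neg_pos.2 (hneg r hr))
  · exact not_pos_variation hf1 hf2 hq1 hq2 h0r₁ hr₁₂ hmem hu' hv hv₁ hv₂ hφ' hψc ⟨C, hψb⟩ hψ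
      hcons hpos
end
end

section
/- Assume f satisfies (f1), (f2), (f5) and q satisfies (q1), (q2). Let u be a solution of (E) with u(0) = α > b that is strictly decreasing on (0,R] with u(r) > b for r ∈ [0,R) and u(R) = b, and let φ be a first variation along u. Then φ(r) > 0 for all r ∈ (0,R). -/
open Set Filter MeasureTheory Topology

noncomputable section

theorem ContDiffOn.hasDerivAt_of_Ici {g : ℝ → ℝ} {a r : ℝ} (hg : ContDiffOn ℝ 1 g (Ici a))
    (hr : a < r) : HasDerivAt g (deriv g r) r :=
  ((hg.contDiffAt (Ici_mem_nhds hr)).differentiableAt one_ne_zero).hasDerivAt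

theorem derivWithin_Ici_eventuallyEq_deriv (g : ℝ → ℝ) {a r : ℝ} (hr : a < r) :
    derivWithin g (Ici a) =ᶠ[𝓝 r] deriv g := by
  filter_upwards [Ioi_mem_nhds hr] with t ht
  exact derivWithin_of_mem_nhds (Ici_mem_nhds ht)

theorem monotoneOn_Icc_of_hasDerivAt_nonneg {g g' : ℝ → ℝ} {a b : ℝ}
    (hc : ContinuousOn g (Icc a b)) (hd : ∀ r ∈ Ioo a b, HasDerivAt g (g' r) r)
    (hn : ∀ r ∈ Ioo a b, 0 ≤ g' r) : MonotoneOn g (Icc a b) := by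
  refine monotoneOn_of_hasDerivWithinAt_nonneg (f' := g') (convex_Icc a b) hc ?_ ?_ <;>
    rw [interior_Icc]
  · exact fun r hr => (hd r hr).hasDerivWithinAt
  · exact hn

/-- Sturm comparison for `(q v')' + q g = 0` and `(q φ')' + q k φ = 0` with singular weight
`q 0 = 0`: if `k v ≤ g` and `0 ≤ φ` on `(0, ρ)`, then the Wronskian `v φ' - φ v'` is
nonnegative there. -/
theorem wronskian_nonneg {q v φ g k : ℝ → ℝ} {ρ : ℝ}
    (hq0 : q 0 = 0) (hqc : ContinuousWithinAt q (Ici 0) 0)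
    (hqd : ∀ r, 0 < r → DifferentiableAt ℝ q r) (hqpos : ∀ r, 0 < r → 0 < q r)
    (hv : ContDiffOn ℝ 1 v (Ici 0)) (hφ : ContDiffOn ℝ 1 φ (Ici 0))
    (hv2 : ∀ r ∈ Ioo 0 ρ, DifferentiableAt ℝ (deriv v) r)
    (hφ2 : ∀ r ∈ Ioo 0 ρ, DifferentiableAt ℝ (deriv φ) r)
    (hvode : ∀ r ∈ Ioo 0 ρ, deriv (deriv v) r + deriv q r / q r * deriv v r + g r = 0)
    (hφode : ∀ r ∈ Ioo 0 ρ,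
      deriv (deriv φ) r + deriv q r / q r * deriv φ r + k r * φ r = 0)
    (hgk : ∀ r ∈ Ioo 0 ρ, k r * v r ≤ g r) (hφnn : ∀ r ∈ Ioo 0 ρ, 0 ≤ φ r) :
    ∀ r ∈ Ioo 0 ρ, 0 ≤ v r * deriv φ r - φ r * deriv v r := by
  set W : ℝ → ℝ := fun r =>
    q r * (v r * derivWithin φ (Ici 0) r - φ r * derivWithin v (Ici 0) r) with hW
  have hqcont : ContinuousOn q (Ici 0) := by
    intro r hr
    rcases eq_or_lt_of_le (mem_Ici.1 hr) with rfl | h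
    · exact hqc
    · exact (hqd r h).continuousAt.continuousWithinAt
  have hWc : ContinuousOn W (Ici 0) :=
    hqcont.mul ((hv.continuousOn.mul
      (hφ.continuousOn_derivWithin (uniqueDiffOn_Ici 0) le_rfl)).sub
      (hφ.continuousOn.mul (hv.continuousOn_derivWithin (uniqueDiffOn_Ici 0) le_rfl)))
  have hWd : ∀ r ∈ Ioo 0 ρ, HasDerivAt W (q r * φ r * (g r - k r * v r)) r := by
    intro r hr
    have h := (hqd r hr.1).hasDerivAt.mul
      (((hv.hasDerivAt_of_Ici hr.1).mul (hφ2 r hr).hasDerivAt).sub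
        ((hφ.hasDerivAt_of_Ici hr.1).mul (hv2 r hr).hasDerivAt))
    have heq : W =ᶠ[𝓝 r] q * (v * deriv φ - φ * deriv v) := by
      filter_upwards [derivWithin_Ici_eventuallyEq_deriv φ hr.1,
        derivWithin_Ici_eventuallyEq_deriv v hr.1] with t h1 h2
      simp [hW, h1, h2]
    refine (h.congr_of_eventuallyEq heq).congr_deriv ?_
    have hq := (hqpos r hr.1).ne'
    have h1 := hvode r hr
    have h2 := hφode r hr
    field_simp at h1 h2
    simp only [Pi.mul_apply, Pi.sub_apply]
    linear_combination v r * h2 - φ r * h1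
  have hmono : MonotoneOn W (Icc 0 ρ) :=
    monotoneOn_Icc_of_hasDerivAt_nonneg (hWc.mono Icc_subset_Ici_self) hWd fun r hr =>
      mul_nonneg (mul_nonneg (hqpos r hr.1).le (hφnn r hr)) (sub_nonneg.2 (hgk r hr))
  intro r hr
  have h := hmono ⟨le_rfl, (hr.1.trans hr.2).le⟩ ⟨hr.1.le, hr.2.le⟩ hr.1.le
  simp only [hW, hq0, zero_mul, (derivWithin_Ici_eventuallyEq_deriv φ hr.1).eq_of_nhds,
    (derivWithin_Ici_eventuallyEq_deriv v hr.1).eq_of_nhds] at h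
  exact nonneg_of_mul_nonneg_right h (hqpos r hr.1)

/-- In the sublinear case (f5), the first variation is strictly
positive while the decreasing solution stays above `b`. -/
theorem variation_positive_above_b
    (c : EReal) (f q : ℝ → ℝ) (b β : ℝ) (hc : 0 < c)
    (hf1 : CondF1 c f b β) (hf2 : CondF2 c f) (hf5 : CondF5 c f b)
    (hq1 : CondQ1 q) (hq2 : CondQ2 q)
    (u φ : ℝ → ℝ) (hu : IsSolutionE c f q u)
    (hφ : IsFirstVariation c f q u φ)
    (α : ℝ) (hα : b < α) (hu0 : u 0 = α)
    (R : ℝ) (hR : 0 < R)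
    (hdec : StrictAntiOn u (Ioc 0 R))
    (habove : ∀ r ∈ Ico (0:ℝ) R, b < u r) (huR : u R = b) :
    ∀ r ∈ Ioo (0:ℝ) R, 0 < φ r := by
  intro r₁ hr₁
  by_contra! hneg
  obtain ⟨ρ, ⟨hρmem, hρφ⟩, hρmin⟩ :
      ∃ ρ, IsLeast {r | r ∈ Icc 0 r₁ ∧ φ r ≤ 0} ρ := by
    have hclosed : IsClosed {r | r ∈ Icc 0 r₁ ∧ φ r ≤ 0} :=
      (hφ.c1.continuousOn.mono Icc_subset_Ici_self).preimage_isClosed_of_isClosed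
        isClosed_Icc isClosed_Iic
    exact (isCompact_Icc.of_isClosed_subset hclosed fun r hr => hr.1).exists_isLeast
      ⟨r₁, ⟨hr₁.1.le, le_rfl⟩, hneg⟩
  have hρ0 : 0 < ρ := by
    refine lt_of_le_of_ne hρmem.1 fun h => ?_
    rw [← h, hφ.init] at hρφ
    linarith
  have hρR : ρ < R := hρmem.2.trans_lt hr₁.2
  have hφpos : ∀ r ∈ Ioo 0 ρ, 0 < φ r := fun r hr => by
    by_contra! h
    exact hr.2.not_ge (hρmin ⟨⟨hr.1.le, hr.2.le.trans hρmem.2⟩, h⟩)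
  have hb : 0 < b := hf1.2.2.1
  set v : ℝ → ℝ := fun r => u r - b with hv
  have hvd : deriv v = deriv u := by
    funext r
    simp [hv]
  have hvpos : ∀ r ∈ Icc 0 ρ, 0 < v r := fun r hr =>
    sub_pos.2 (habove r ⟨hr.1, hr.2.trans_lt hρR⟩)
  have hune : ∀ r ∈ Ioo 0 ρ, u r ≠ 0 := fun r hr =>
    (hb.trans (habove r ⟨hr.1.le, hr.2.trans hρR⟩)).ne'
  have hvc1 : ContDiffOn ℝ 1 v (Ici 0) := hu.c1.sub contDiffOn_const
  have hwr := wronskian_nonneg (v := v) (φ := φ) (g := fun r => f (u r))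
    (k := fun r => deriv f (u r)) (ρ := ρ) hq1.2.2.1 hq1.2.2.2
    (fun r hr => (hq1.1.contDiffAt (Ioi_mem_nhds hr)).differentiableAt one_ne_zero)
    (fun r hr => (hq1.2.1 r hr).1) hvc1 hφ.c1
    (fun r hr => hvd ▸ hu.diff2 r hr.1) (fun r hr => hφ.diff2 r hr.1 (hune r hr))
    (fun r hr => hvd ▸ hu.ode r hr.1) (fun r hr => hφ.ode r hr.1 (hune r hr))
    (fun r hr => hf5 _ (habove r ⟨hr.1.le, hr.2.trans hρR⟩).le (hu.mem r hr.1.le).2)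
    (fun r hr => (hφpos r hr).le)
  have hmono : MonotoneOn (fun r => φ r / v r) (Icc 0 ρ) := by
    refine monotoneOn_Icc_of_hasDerivAt_nonneg
      ((hφ.c1.continuousOn.mono Icc_subset_Ici_self).div
        (hvc1.continuousOn.mono Icc_subset_Ici_self) fun r hr => (hvpos r hr).ne')
      (fun r hr => (hφ.c1.hasDerivAt_of_Ici hr.1).div (hvc1.hasDerivAt_of_Ici hr.1)
        (hvpos r (Ioo_subset_Icc_self hr)).ne') fun r hr => ?_
    refine div_nonneg ?_ (sq_nonneg _)
    linarith [hwr r hr]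
  have h0 : 0 < φ 0 / v 0 := div_pos (by simp [hφ.init]) (hvpos 0 ⟨le_rfl, hρ0.le⟩)
  have hle : φ 0 / v 0 ≤ φ ρ / v ρ := hmono ⟨le_rfl, hρ0.le⟩ ⟨hρ0.le, le_rfl⟩ hρ0.le
  exact (h0.trans_le hle).not_ge
    (div_nonpos_of_nonpos_of_nonneg hρφ (hvpos ρ ⟨hρ0.le, le_rfl⟩).le)
end
end

section
/- Assume q satisfies (q1), (q2), (q3) and (q4). Then the limits H∞ and ℓ∞ are related by H∞ = ℓ∞/(1 + 2·ℓ∞); equivalently, H∞/ℓ∞ = 1 − 2·H∞. -/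
open Set Filter MeasureTheory Topology

noncomputable section

/-- If `f' → L` at infinity then `f r / r → L`. -/
theorem tendsto_div_id_of_tendsto_deriv {f : ℝ → ℝ} {L : ℝ}
    (hf : ∀ᶠ r in atTop, DifferentiableAt ℝ f r)
    (hL : Tendsto (deriv f) atTop (𝓝 L)) :
    Tendsto (fun r => f r / r) atTop (𝓝 L) := by
  rw [Metric.tendsto_atTop]
  intro ε hε
  have hclose : ∀ᶠ r in atTop, dist (deriv f r) L < ε / 2 :=
    hL.eventually (Metric.ball_mem_nhds L (half_pos hε))
  obtain ⟨M, hM⟩ := eventually_atTop.1 (hf.and (hclose.and (eventually_gt_atTop 0)))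
  have hM0 : 0 < M := (hM M le_rfl).2.2
  have hconst : Tendsto (fun r : ℝ => |f M - L * M| / r) atTop (𝓝 0) :=
    tendsto_const_nhds.div_atTop tendsto_id
  obtain ⟨N, hN⟩ := eventually_atTop.1 (hconst.eventually (gt_mem_nhds (half_pos hε)))
  refine ⟨max M N, fun r hr => ?_⟩
  have hrM : M ≤ r := (le_max_left _ _).trans hr
  have hr0 : 0 < r := hM0.trans_le hrM
  have hmv : ‖(f r - L * r) - (f M - L * M)‖ ≤ ε / 2 * ‖r - M‖ := by
    refine (convex_Ici M).norm_image_sub_le_of_norm_hasDerivWithin_le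
      (f := fun x => f x - L * x) (f' := fun x => deriv f x - L)
      (fun x hx => ?_) (fun x hx => ?_) self_mem_Ici hrM
    · have hd := (hM x hx).1.hasDerivAt.sub ((hasDerivAt_id x).const_mul L)
      rw [mul_one] at hd
      exact hd.hasDerivWithinAt
    · have := (hM x hx).2.1
      rw [Real.dist_eq] at this
      exact this.le
  rw [Real.norm_eq_abs, Real.norm_eq_abs, abs_of_nonneg (sub_nonneg.2 hrM)] at hmv
  have hc := hN r ((le_max_right _ _).trans hr)
  rw [div_lt_iff₀ hr0] at hc
  have hsub : f r / r - L = (f r - L * r) / r := by field_simp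
  rw [Real.dist_eq, hsub, abs_div, abs_of_pos hr0, div_lt_iff₀ hr0]
  have htri := abs_sub_abs_le_abs_sub (f r - L * r) (f M - L * M)
  nlinarith [mul_pos hε hM0]

/-- `Q' = q` on `(0,∞)`. -/
theorem hasDerivAt_Qint {q : ℝ → ℝ} (hq : CondQ1 q) {r : ℝ} (hr : 0 < r) :
    HasDerivAt (Qint q) (q r) r := by
  have hcont : ContinuousOn q (Ici 0) := by
    intro x hx
    rcases eq_or_lt_of_le (mem_Ici.1 hx) with rfl | hx
    · exact hq.2.2.2
    · exact (hq.1.continuousOn.continuousAt (Ioi_mem_nhds hx)).continuousWithinAt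
  refine intervalIntegral.integral_hasDerivAt_right ?_ ?_
    (hcont.continuousAt (Ici_mem_nhds hr))
  · refine (hcont.mono ?_).intervalIntegrable
    rw [uIcc_of_le hr.le]
    exact Icc_subset_Ici_self
  · exact hq.1.continuousOn.stronglyMeasurableAtFilter isOpen_Ioi r hr

/-- The derivative of `r ↦ ∫_r^∞ ds / q(s)` for `r > 1`. -/
theorem hasDerivAt_integral_Ioi_one_div {q : ℝ → ℝ} (hq : CondQ1 q)
    (hint : IntegrableOn (fun r => 1 / q r) (Ioi (1 : ℝ))) {r : ℝ} (hr : 1 < r) :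
    HasDerivAt (fun t => ∫ s in Ioi t, 1 / q s) (-(1 / q r)) r := by
  have hcont : ContinuousOn (fun s => 1 / q s) (Ioi 0) :=
    continuousOn_const.div hq.1.continuousOn fun s hs => (hq.2.1 s hs).1.ne'
  have hr0 : 0 < r := zero_lt_one.trans hr
  have hI : HasDerivAt (fun t => ∫ s in (1 : ℝ)..t, 1 / q s) (1 / q r) r := by
    refine intervalIntegral.integral_hasDerivAt_right ?_
      (hcont.stronglyMeasurableAtFilter isOpen_Ioi r hr0)
      (hcont.continuousAt (Ioi_mem_nhds hr0))
    refine (hcont.mono ?_).intervalIntegrable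
    rw [uIcc_of_le hr.le]
    exact fun x hx => zero_lt_one.trans_le hx.1
  refine (hI.const_sub (∫ s in Ioi (1 : ℝ), 1 / q s)).congr_of_eventuallyEq ?_
  filter_upwards [Ioi_mem_nhds hr] with t ht
  have := intervalIntegral.integral_interval_add_Ioi hint
    (hint.mono_set (Ioi_subset_Ioi (le_of_lt ht)))
  linarith

/-- Under (q1)-(q4), the limits `H∞` and `ℓ∞` are related by
`H∞ = ℓ∞/(1 + 2ℓ∞)`, equivalently `H∞/ℓ∞ = 1 − 2H∞`. -/
theorem Hinf_linf_relation
    (q : ℝ → ℝ) (Hinf linf : ℝ)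
    (hq1 : CondQ1 q) (hq2 : CondQ2 q) (hq3 : CondQ3 q Hinf)
    (hq4 : CondQ4 q linf) :
    Hinf = linf / (1 + 2 * linf) ∧ Hinf / linf = 1 - 2 * Hinf := by
  obtain ⟨-, -, hHlim, -, -⟩ := hq3
  obtain ⟨hint, -, -, -, hllim, hl⟩ := hq4
  have hq : ∀ r, 0 < r → HasDerivAt q (deriv q r) r := fun r hr =>
    ((hq1.1.differentiableOn one_ne_zero).differentiableAt (Ioi_mem_nhds hr)).hasDerivAt
  have hH : ∀ r, 0 < r → HasDerivAt (fun t => Qint q t / q t)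
      ((q r * q r - Qint q r * deriv q r) / q r ^ 2) r := fun r hr =>
    (hasDerivAt_Qint hq1 hr).div (hq r hr) (hq1.2.1 r hr).1.ne'
  have hh : ∀ r, 1 < r → HasDerivAt (hfun q)
      (deriv q r * (∫ s in Ioi r, 1 / q s) + q r * -(1 / q r)) r := fun r hr =>
    (hq r (zero_lt_one.trans hr)).mul (hasDerivAt_integral_Ioi_one_div hq1 hint hr)
  have hHdiv : Tendsto (fun r => Qint q r / q r / r) atTop (𝓝 Hinf) :=
    tendsto_div_id_of_tendsto_deriv
      ((eventually_gt_atTop 0).mono fun r hr => (hH r hr).differentiableAt) hHlim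
  have hhdiv : Tendsto (fun r => hfun q r / r) atTop (𝓝 linf) :=
    tendsto_div_id_of_tendsto_deriv
      ((eventually_gt_atTop 1).mono fun r hr => (hh r hr).differentiableAt) hllim
  have hprod : Tendsto (fun r => 1 - Hfun q r) atTop (𝓝 (Hinf * ((linf + 1) / linf))) := by
    refine (hHdiv.mul ((hllim.add_const 1).div hhdiv hl.ne')).congr' ?_
    filter_upwards [eventually_gt_atTop 1, hhdiv.eventually (lt_mem_nhds hl)] with r hr hpos
    have hr0 : 0 < r := zero_lt_one.trans hr
    have hqr : q r ≠ 0 := (hq1.2.1 r hr0).1.ne'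
    have hR : (∫ s in Ioi r, 1 / q s) ≠ 0 := by
      intro h0
      simp only [hfun, h0, mul_zero, zero_div, lt_irrefl] at hpos
    rw [Pi.div_apply, (hh r hr).deriv, Hfun, (hH r hr0).deriv, hfun]
    generalize (∫ s in Ioi r, 1 / q s) = R at hR ⊢
    field_simp
    ring
  have hrel := tendsto_nhds_unique hprod (hHlim.const_sub 1)
  have hl' : 1 + 2 * linf ≠ 0 := by positivity
  field_simp at hrel
  constructor
  · rw [eq_div_iff hl']
    linarith
  · rw [div_eq_iff hl.ne']
    linarith
end
end
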